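/- arXiv:2110.03650 — 4 statements merged into one kernel-verified Lean document; each statement's English description precedes it below -/
import Mathlib

section
/- Let k be an algebraically closed field of characteristic p = 2 and let R = k⟦x,y,z⟧/(z^2 + x^3 + xy^3 + y^3 z) (the rational double point of type E_7^2 in characteristic 2). Let τ := the Teichmüller lift of z/(xy) in 𝕎L, and let N_2 ⊆ 𝕎L be as in the context (with l = 2). Then: (i) F(τ) + V(τ) ∈ N_2; (ii) τ ∉ N_2; (iii) V(τ) ∉ N_2. Equivalently, the class of the length-2 Teichmüller lift of z/(xy) in H^2_m(R, W_2O) is nonzero, satisfies (F + V)(class) = 0, and is not annihilated by Verschiebung; this realizes the relations (F + V) ≡ V^2 ≡ 0 on the generator f_1^{(2)} of the Dieudonné module of E_7^2 in characteristic 2, which has length 2 (corresponding to Picloc^{loc,loc} ≅ M_2). -/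
set_option maxHeartbeats 1000000
set_option synthInstance.maxHeartbeats 400000

open MvPowerSeries

noncomputable section

variable (k : Type) [Field k]

/-- The formal power series ring `k⟦x,y,z⟧`. -/
abbrev PS := MvPowerSeries (Fin 3) k

/-- The hypersurface singularity `R = k⟦x,y,z⟧/(f)`. -/
abbrev Rq (f : PS k) : Type := PS k ⧸ Ideal.span {f}

/-- The image of `x` in `R`. -/
abbrev xR (f : PS k) : Rq k f := Ideal.Quotient.mk _ (X 0)
/-- The image of `y` in `R`. -/
abbrev yR (f : PS k) : Rq k f := Ideal.Quotient.mk _ (X 1)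
/-- The image of `z` in `R`. -/
abbrev zR (f : PS k) : Rq k f := Ideal.Quotient.mk _ (X 2)

/-- `L`: the localization of `R` inverting `x*y`. -/
abbrev Lloc (f : PS k) : Type := Localization.Away (xR k f * yR k f)

/-- The canonical map from the localization of `R` inverting `x` to `L`. -/
noncomputable def phiX (f : PS k) : Localization.Away (xR k f) →+* Lloc k f :=
  IsLocalization.Away.awayToAwayRight (S := Localization.Away (xR k f)) (P := Lloc k f)
    (xR k f) (yR k f)

/-- The canonical map from the localization of `R` inverting `y` to `L`. -/
noncomputable def phiY (f : PS k) : Localization.Away (yR k f) →+* Lloc k f :=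
  IsLocalization.Away.awayToAwayLeft (S := Localization.Away (yR k f)) (P := Lloc k f)
    (yR k f) (xR k f)

/-- `A ⊆ L`: the `R`-submodule generated by the images of `R_x` and `R_y` in `L`.
The quotient `L/A` is a Čech description of the local cohomology `H^2_m(R)`. -/
def Asub (f : PS k) : Submodule (Rq k f) (Lloc k f) :=
  Submodule.span (Rq k f) (Set.range (phiX k f) ∪ Set.range (phiY k f))

/-- The element `z/(x*y) ∈ L`. -/
noncomputable def zxy (f : PS k) : Lloc k f :=
  Localization.mk (zR k f) ⟨xR k f * yR k f, Submonoid.mem_powers _⟩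

/-- The element `f_j := z/(x*y^j) = z*x^(j-1)/(x*y)^j ∈ L` (for `j ≥ 1`). -/
noncomputable def fcls (f : PS k) (j : ℕ) : Lloc k f :=
  Localization.mk (zR k f * xR k f ^ (j - 1)) ⟨(xR k f * yR k f) ^ j, j, rfl⟩

/-- `N_l ⊆ 𝕎L`: the additive subgroup generated by the images of the Witt vectors of the
localizations of `R` inverting `x` and inverting `y`, together with the image of `V^l`.
The quotient `𝕎L/N_l` is a Čech description of the local cohomology `H^2_m(R, W_lO)`. -/
def Nsub (p : ℕ) [Fact p.Prime] (f : PS k) (l : ℕ) : AddSubgroup (WittVector p (Lloc k f)) :=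
  AddSubgroup.closure
    (Set.range (WittVector.map (p := p) (phiX k f) :
        WittVector p (Localization.Away (xR k f)) → WittVector p (Lloc k f)) ∪
      Set.range (WittVector.map (p := p) (phiY k f) :
        WittVector p (Localization.Away (yR k f)) → WittVector p (Lloc k f)) ∪
      Set.range ((⇑(WittVector.verschiebung (p := p) (R := Lloc k f)))^[l]))

instance : Fact (Nat.Prime 2) := ⟨by norm_num⟩

/-- The defining equation of the rational double point of type `E_7^2` in characteristic `2`. -/
abbrev fE7p2 : PS k := X 2 ^ 2 + X 0 ^ 3 + X 0 * X 1 ^ 3 + X 1 ^ 3 * X 2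

section PowerSeries

variable {k}

lemma MvPowerSeries.coeff_X_pow_mul_of_lt {σ R : Type*} [CommSemiring R] {m : σ →₀ ℕ} {s : σ}
    {n : ℕ} (h : m s < n) (φ : MvPowerSeries σ R) : coeff m (X s ^ n * φ) = 0 := by
  rw [X_pow_eq, coeff_monomial_mul, if_neg]
  intro hle
  have := hle s
  rw [Finsupp.single_eq_same] at this
  omega

lemma fE7p2_eq : fE7p2 k = monomial (Finsupp.single 2 2) 1 + monomial (Finsupp.single 0 3) 1 +
    monomial (Finsupp.single 0 1 + Finsupp.single 1 3) 1 +
    monomial (Finsupp.single 1 3 + Finsupp.single 2 1) 1 := by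
  rw [fE7p2, X_pow_eq, X_pow_eq, X_pow_eq, X, X, monomial_mul_monomial, monomial_mul_monomial,
    one_mul]

/-- If all coefficients of `f * g` on the box `i, j ≤ N` vanish for `n ≥ 2`, so do all the
coefficients of `g` on that box. -/
lemma coeff_eq_zero_of_coeff_fE7p2_mul {N : ℕ} {g : PS k}
    (h : ∀ m : Fin 3 →₀ ℕ, m 0 ≤ N → m 1 ≤ N → 2 ≤ m 2 → coeff m (fE7p2 k * g) = 0)
    (d : ℕ) (m : Fin 3 →₀ ℕ) (hd : m 0 + m 1 = d) (h0 : m 0 ≤ N) (h1 : m 1 ≤ N) :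
    coeff m g = 0 := by
  induction d using Nat.strong_induction_on generalizing m with
  | _ d ih =>
    have key := h (Finsupp.single 2 2 + m) (by simpa using h0) (by simpa using h1) (by simp)
    have vanish (e : Fin 3 →₀ ℕ) (he : 0 < e 0 + e 1) :
        coeff (Finsupp.single 2 2 + m) (monomial e (1 : k) * g) = 0 := by
      rw [coeff_monomial_mul]
      split_ifs with hle
      · have l0 := hle 0
        have l1 := hle 1
        simp only [Finsupp.add_apply, ne_eq, Fin.reduceEq, not_false_eq_true,
          Finsupp.single_eq_of_ne, zero_add] at l0 l1
        rw [one_mul]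
        refine ih _ ?_ _ rfl ?_ ?_ <;>
          simp only [Finsupp.tsub_apply, Finsupp.add_apply, ne_eq, Fin.reduceEq,
            not_false_eq_true, Finsupp.single_eq_of_ne, zero_add] <;> omega
      · rfl
    rw [fE7p2_eq, add_mul, add_mul, add_mul, map_add, map_add, map_add, coeff_add_monomial_mul,
      vanish _ (by simp), vanish _ (by simp), vanish _ (by simp)] at key
    simpa using key

lemma X_mul_pow_ne (N : ℕ) (r s g : PS k) :
    X 2 * (X 0 * X 1) ^ N ≠ r * X 0 ^ (N + 1) + s * X 1 ^ (N + 1) + fE7p2 k * g := by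
  intro h
  have hm : (X 2 * (X 0 * X 1) ^ N : PS k) =
      monomial (Finsupp.single 2 1 + (Finsupp.single 0 N + Finsupp.single 1 N)) 1 := by
    rw [mul_pow, X_pow_eq, X_pow_eq, X, monomial_mul_monomial, monomial_mul_monomial, one_mul,
      one_mul]
  have hc (m : Fin 3 →₀ ℕ) (h0 : m 0 ≤ N) (h1 : m 1 ≤ N) :
      coeff m (X 2 * (X 0 * X 1) ^ N : PS k) = coeff m (fE7p2 k * g) := by
    rw [h, map_add, map_add, mul_comm r, mul_comm s, coeff_X_pow_mul_of_lt (by omega),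
      coeff_X_pow_mul_of_lt (by omega), zero_add, zero_add]
  have hg : ∀ m : Fin 3 →₀ ℕ, m 0 ≤ N → m 1 ≤ N → coeff m g = 0 := by
    refine fun m ↦ coeff_eq_zero_of_coeff_fE7p2_mul (fun m h0 h1 h2 ↦ ?_) _ m rfl
    classical
    rw [← hc m h0 h1, hm, coeff_monomial, if_neg]
    rintro rfl
    simp at h2
  have key := hc (Finsupp.single 2 1 + (Finsupp.single 0 N + Finsupp.single 1 N))
    (by simp) (by simp)
  have vanish (e : Fin 3 →₀ ℕ) :
      coeff (Finsupp.single 2 1 + (Finsupp.single 0 N + Finsupp.single 1 N))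
        (monomial e (1 : k) * g) = 0 := by
    rw [coeff_monomial_mul]
    split_ifs
    · rw [hg, mul_zero] <;> simp
    · rfl
  rw [hm, coeff_monomial_same, fE7p2_eq, add_mul, add_mul, add_mul, map_add, map_add, map_add,
    vanish, vanish, vanish, vanish] at key
  simp at key

end PowerSeries

section Localization

variable {k}

lemma phiX_algebraMap (f : PS k) (r : Rq k f) :
    phiX k f (algebraMap _ _ r) = algebraMap _ _ r :=
  IsLocalization.Away.awayToAwayRight_eq _ _ _

lemma phiY_algebraMap (f : PS k) (r : Rq k f) :
    phiY k f (algebraMap _ _ r) = algebraMap _ _ r :=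
  IsLocalization.Away.awayToAwayLeft_eq _ _ _

lemma zxy_mul (f : PS k) :
    zxy k f * algebraMap _ _ (xR k f * yR k f) = algebraMap _ _ (zR k f) := by
  rw [zxy, Localization.mk_eq_mk']
  exact IsLocalization.mk'_spec _ _
    (⟨_, Submonoid.mem_powers _⟩ : Submonoid.powers (xR k f * yR k f))

lemma mk_z_mul_pow_ne (N : ℕ) (r s : Rq k (fE7p2 k)) :
    zR k (fE7p2 k) * (xR k (fE7p2 k) * yR k (fE7p2 k)) ^ N ≠
      r * xR k (fE7p2 k) ^ (N + 1) + s * yR k (fE7p2 k) ^ (N + 1) := by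
  obtain ⟨r, rfl⟩ := Ideal.Quotient.mk_surjective r
  obtain ⟨s, rfl⟩ := Ideal.Quotient.mk_surjective s
  intro h
  simp only [← map_pow, ← map_mul, ← map_add] at h
  rw [Ideal.Quotient.eq, Ideal.mem_span_singleton] at h
  obtain ⟨g, hg⟩ := h
  exact X_mul_pow_ne N r s g (by rw [← hg]; ring)

/-- The class of `z/(xy)` in `H^2_m(R)` is nonzero. -/
lemma zxy_ne_add (a : Localization.Away (xR k (fE7p2 k)))
    (b : Localization.Away (yR k (fE7p2 k))) :
    zxy k (fE7p2 k) ≠ phiX k _ a + phiY k _ b := by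
  intro h
  obtain ⟨n, r, hr⟩ := IsLocalization.Away.surj (xR k (fE7p2 k)) a
  obtain ⟨m, s, hs⟩ := IsLocalization.Away.surj (yR k (fE7p2 k)) b
  have hr' := congrArg (phiX k _) hr
  have hs' := congrArg (phiY k _) hs
  rw [map_mul, map_pow, phiX_algebraMap, phiX_algebraMap] at hr'
  rw [map_mul, map_pow, phiY_algebraMap, phiY_algebraMap] at hs'
  have hz := zxy_mul (fE7p2 k)
  rw [h] at hz
  have hL : algebraMap _ (Lloc k (fE7p2 k))
      (zR k (fE7p2 k) * (xR k (fE7p2 k) * yR k (fE7p2 k)) ^ (n + m)) =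
      algebraMap _ _ (r * xR k (fE7p2 k) ^ (m + 1) * yR k (fE7p2 k) ^ (n + m + 1) +
        s * yR k (fE7p2 k) ^ (n + 1) * xR k (fE7p2 k) ^ (n + m + 1)) := by
    rw [map_mul] at hz
    simp only [map_mul, map_add, map_pow, ← hr', ← hs', ← hz]
    ring
  obtain ⟨⟨_, M, rfl⟩, hM⟩ :=
    IsLocalization.exists_of_eq (M := Submonoid.powers (xR k (fE7p2 k) * yR k (fE7p2 k))) hL
  refine mk_z_mul_pow_ne (n + m + M) (s * yR k (fE7p2 k) ^ (n + 1 + M))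
    (r * xR k (fE7p2 k) ^ (m + 1 + M)) ?_
  simp only at hM
  calc _ = (xR k (fE7p2 k) * yR k (fE7p2 k)) ^ M *
        (zR k (fE7p2 k) * (xR k (fE7p2 k) * yR k (fE7p2 k)) ^ (n + m)) := by ring
    _ = _ := by rw [hM]; ring

lemma two_eq_zero_Lloc [CharP k 2] (f : PS k) : (2 : Lloc k f) = 0 := by
  have h := congrArg (fun c ↦ algebraMap (Rq k f) (Lloc k f)
    (Ideal.Quotient.mk _ (C (σ := Fin 3) c))) (CharTwo.two_eq_zero (R := k))
  simpa only [map_ofNat, map_zero] using h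

lemma charP_two_Lloc [CharP k 2] : CharP (Lloc k (fE7p2 k)) 2 := by
  refine CharTwo.of_one_ne_zero_of_two_eq_zero (fun h ↦ zxy_ne_add (k := k) 0 0 ?_)
    (two_eq_zero_Lloc _)
  rw [← mul_one (zxy k _), h]
  simp

end Localization

section WittVector

lemma WittVector.wittAdd_two_one : WittVector.wittAdd 2 1 =
    MvPolynomial.X (0, 1) + MvPolynomial.X (1, 1) -
      MvPolynomial.X (0, 0) * MvPolynomial.X (1, 0) := by
  have h := wittStructureInt_prop 2 (MvPolynomial.X 0 + MvPolynomial.X 1 :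
    MvPolynomial (Fin 2) ℤ) 1
  change MvPolynomial.bind₁ (WittVector.wittAdd 2) _ = _ at h
  rw [wittPolynomial_one] at h
  simp only [map_add, map_mul, map_pow, MvPolynomial.bind₁_X_right, MvPolynomial.rename_X,
    WittVector.wittAdd_zero, Nat.cast_ofNat, map_ofNat] at h
  have h2 : (2 : MvPolynomial (Fin 2 × ℕ) ℤ) ≠ 0 := two_ne_zero
  refine mul_left_cancel₀ h2 ?_
  linear_combination h

lemma WittVector.add_coeff_one_two {A : Type*} [CommRing A] (a b : WittVector 2 A) :
    (a + b).coeff 1 = a.coeff 1 + b.coeff 1 - a.coeff 0 * b.coeff 0 := by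
  simp [WittVector.add_coeff, WittVector.wittAdd_two_one, WittVector.peval, Function.uncurry]

lemma exists_of_mem_Nsub {k : Type} [Field k] {p : ℕ} [Fact p.Prime] {f : PS k} {l : ℕ}
    {w : WittVector p (Lloc k f)} (hw : w ∈ Nsub k p f l) :
    ∃ a b c, w = WittVector.map (phiX k f) a + WittVector.map (phiY k f) b +
      WittVector.verschiebung^[l] c := by
  induction hw using AddSubgroup.closure_induction with
  | mem w hw =>
    obtain (⟨a, rfl⟩ | ⟨b, rfl⟩) | ⟨c, rfl⟩ := hw
    · exact ⟨a, 0, 0, by simp [iterate_map_zero]⟩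
    · exact ⟨0, b, 0, by simp [iterate_map_zero]⟩
    · exact ⟨0, 0, c, by simp⟩
  | zero => exact ⟨0, 0, 0, by simp [iterate_map_zero]⟩
  | add _ _ _ _ h₁ h₂ =>
    obtain ⟨a, b, c, rfl⟩ := h₁
    obtain ⟨a', b', c', rfl⟩ := h₂
    refine ⟨a + a', b + b', c + c', ?_⟩
    rw [map_add, map_add, iterate_map_add]
    abel
  | neg _ _ h =>
    obtain ⟨a, b, c, rfl⟩ := h
    refine ⟨-a, -b, -c, ?_⟩
    rw [map_neg, map_neg, iterate_map_neg]
    abel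

lemma exists_coeff_of_mem_Nsub_two {k : Type} [Field k] {f : PS k}
    {w : WittVector 2 (Lloc k f)} (hw : w ∈ Nsub k 2 f 2) :
    ∃ a₀ a₁ b₀ b₁, w.coeff 0 = phiX k f a₀ + phiY k f b₀ ∧
      w.coeff 1 = phiX k f a₁ + phiY k f b₁ - phiX k f a₀ * phiY k f b₀ := by
  obtain ⟨a, b, c, rfl⟩ := exists_of_mem_Nsub hw
  refine ⟨a.coeff 0, a.coeff 1, b.coeff 0, b.coeff 1, ?_, ?_⟩ <;>
    simp [WittVector.add_coeff_zero, WittVector.add_coeff_one_two, WittVector.map_coeff]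

lemma mem_Nsub_two_of_coeff {k : Type} [Field k] {f : PS k}
    {w : WittVector 2 (Lloc k f)} (a₀ a₁ b₀ b₁)
    (h0 : w.coeff 0 = phiX k f a₀ + phiY k f b₀)
    (h1 : w.coeff 1 = phiX k f a₁ + phiY k f b₁ - phiX k f a₀ * phiY k f b₀) :
    w ∈ Nsub k 2 f 2 := by
  set a : WittVector 2 _ := WittVector.mk 2 fun n ↦ if n = 0 then a₀ else a₁
  set b : WittVector 2 _ := WittVector.mk 2 fun n ↦ if n = 0 then b₀ else b₁
  set s := WittVector.map (phiX k f) a + WittVector.map (phiY k f) b with hs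
  have hs0 : s.coeff 0 = phiX k f a₀ + phiY k f b₀ := by
    simp [hs, a, b, WittVector.add_coeff_zero, WittVector.map_coeff]
  have hs1 : s.coeff 1 = phiX k f a₁ + phiY k f b₁ - phiX k f a₀ * phiY k f b₀ := by
    simp [hs, a, b, WittVector.add_coeff_one_two, WittVector.map_coeff]
  have e : s + (w - s) = w := by abel
  have e0 := congrArg (WittVector.coeff · 0) e
  have e1 := congrArg (WittVector.coeff · 1) e
  simp only [WittVector.add_coeff_zero, WittVector.add_coeff_one_two] at e0 e1
  have d0 : (w - s).coeff 0 = 0 := by linear_combination e0 + h0 - hs0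
  have d1 : (w - s).coeff 1 = 0 := by
    linear_combination e1 + h1 - hs1 + s.coeff 0 * d0
  have d := WittVector.eq_iterate_verschiebung (x := w - s) (n := 2) (by
    intro i hi
    interval_cases i
    exacts [d0, d1])
  rw [← e, hs]
  refine add_mem (add_mem ?_ ?_) ?_
  · exact AddSubgroup.subset_closure (Or.inl (Or.inl ⟨a, rfl⟩))
  · exact AddSubgroup.subset_closure (Or.inl (Or.inr ⟨b, rfl⟩))
  · exact AddSubgroup.subset_closure (Or.inr ⟨_, d.symm⟩)

end WittVector

/-- The class of `z/(xy)` squared, split into its parts in `R_x` and `R_y`. -/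
lemma exists_zxy_sq_eq (k : Type) [Field k] [CharP k 2] : ∃ a₀ b₀ b₁,
    zxy k (fE7p2 k) ^ 2 = phiX k _ a₀ + phiY k _ b₀ ∧
    zxy k (fE7p2 k) = phiX k _ 0 + phiY k _ b₁ - phiX k _ a₀ * phiY k _ b₀ := by
  set f := fE7p2 k with hf
  set u : Localization.Away (xR k f) := IsLocalization.Away.invSelf (xR k f)
  set v : Localization.Away (yR k f) := IsLocalization.Away.invSelf (yR k f)
  have hu := congrArg (phiX k f) (IsLocalization.Away.mul_invSelf
    (S := Localization.Away (xR k f)) (xR k f))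
  have hv := congrArg (phiY k f) (IsLocalization.Away.mul_invSelf
    (S := Localization.Away (yR k f)) (yR k f))
  rw [map_mul, map_one, phiX_algebraMap] at hu
  rw [map_mul, map_one, phiY_algebraMap] at hv
  have hrel : zR k f ^ 2 + xR k f ^ 3 + xR k f * yR k f ^ 3 + yR k f ^ 3 * zR k f = 0 := by
    simp only [← map_pow, ← map_mul, ← map_add]
    exact Ideal.Quotient.eq_zero_iff_mem.mpr (Ideal.mem_span_singleton_self _)
  have hL := congrArg (algebraMap _ (Lloc k f)) hrel
  have h2 := two_eq_zero_Lloc f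
  have hz := zxy_mul f
  simp only [map_mul, map_add, map_pow, map_zero] at hL hz
  refine ⟨algebraMap _ _ (yR k f) * u + algebraMap _ _ (yR k f * zR k f) * u ^ 2,
    algebraMap _ _ (xR k f) * v ^ 2, v, ?_, ?_⟩
  all_goals
    simp only [map_mul, map_add, map_pow, map_zero, phiX_algebraMap, phiY_algebraMap]
    change algebraMap _ _ (xR k f) * phiX k f u = 1 at hu
    change algebraMap _ _ (yR k f) * phiY k f v = 1 at hv
    generalize algebraMap _ (Lloc k f) (xR k f) = x at *
    generalize algebraMap _ (Lloc k f) (yR k f) = y at *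
    generalize algebraMap _ (Lloc k f) (zR k f) = z at *
    generalize phiX k f u = U at *
    generalize phiY k f v = V at *
    have ht : zxy k f = z * U * V := by
      linear_combination U * V * hz - zxy k f * y * V * hu - zxy k f * hv
    rw [ht]
  · linear_combination U ^ 2 * V ^ 2 * hL - (x * V ^ 2 * (x * U + 1) + y ^ 3 * U * V ^ 2) * hu -
      (y * U + y * z * U ^ 2) * (y * V + 1) * hv - (y * U + y * z * U ^ 2 + x * V ^ 2) * h2
  · linear_combination z * U * V * h2 + (V + z * U * V) * (y * V * hu + hv)

/-- For the rational double point of type `E_7^2` in characteristic `2`,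
with `τ` the Teichmüller lift of `z/(xy)` in `𝕎L`: `F(τ) + V(τ) ∈ N₂`, `τ ∉ N₂` and
`V(τ) ∉ N₂`; i.e. the class of the length-2 Teichmüller lift of `z/(xy)` in `H^2_m(R, W₂O)`
is nonzero, satisfies `(F + V)(class) = 0`, and is not annihilated by Verschiebung.
This realizes the relations `(F+V) ≡ V² ≡ 0` on the generator `f₁⁽²⁾` of the Dieudonné
module of `E_7^2` in characteristic 2, which has length 2 (corresponding to `M₂`). -/
theorem wittLocalCohomology_E7p2_char2 (k : Type) [Field k] [IsAlgClosed k] [CharP k 2] :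
    -- (i) F(τ) + V(τ) ∈ N₂
    WittVector.frobeniusFun (WittVector.teichmuller 2 (zxy k (fE7p2 k))) +
        WittVector.verschiebung (WittVector.teichmuller 2 (zxy k (fE7p2 k)))
      ∈ Nsub k 2 (fE7p2 k) 2 ∧
    -- (ii) τ ∉ N₂
    WittVector.teichmuller 2 (zxy k (fE7p2 k)) ∉ Nsub k 2 (fE7p2 k) 2 ∧
    -- (iii) V(τ) ∉ N₂
    WittVector.verschiebung (WittVector.teichmuller 2 (zxy k (fE7p2 k)))
      ∉ Nsub k 2 (fE7p2 k) 2 := by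
  have := charP_two_Lloc (k := k)
  have hF : WittVector.frobeniusFun (WittVector.teichmuller 2 (zxy k (fE7p2 k))) =
      WittVector.teichmuller 2 (zxy k (fE7p2 k) ^ 2) := by
    change WittVector.frobenius _ = _
    rw [WittVector.frobenius_eq_map_frobenius, WittVector.map_teichmuller, frobenius_def]
  refine ⟨?_, fun h ↦ ?_, fun h ↦ ?_⟩
  · obtain ⟨a₀, b₀, b₁, h0, h1⟩ := exists_zxy_sq_eq k
    refine mem_Nsub_two_of_coeff a₀ 0 b₀ b₁ ?_ ?_
    · rw [hF, WittVector.add_coeff_zero, WittVector.verschiebung_coeff_zero,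
        WittVector.teichmuller_coeff_zero, add_zero, h0]
    · rw [hF, WittVector.add_coeff_one_two, WittVector.verschiebung_coeff_zero,
        WittVector.teichmuller_coeff_pos _ _ _ one_pos,
        WittVector.verschiebung_coeff_succ _ 0, WittVector.teichmuller_coeff_zero, mul_zero,
        sub_zero, zero_add, h1]
  · obtain ⟨a₀, a₁, b₀, b₁, h0, -⟩ := exists_coeff_of_mem_Nsub_two h
    rw [WittVector.teichmuller_coeff_zero] at h0
    exact zxy_ne_add _ _ h0
  · obtain ⟨a₀, a₁, b₀, b₁, h0, h1⟩ := exists_coeff_of_mem_Nsub_two h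
    rw [WittVector.verschiebung_coeff_zero] at h0
    rw [WittVector.verschiebung_coeff_succ _ 0, WittVector.teichmuller_coeff_zero] at h1
    refine zxy_ne_add (a₁ + a₀ ^ 2) b₁ (h1.trans ?_)
    rw [map_add, map_pow]
    linear_combination phiX k _ a₀ * h0
end
end

section
/- Let k be an algebraically closed field of characteristic p = 2 and let R = k⟦x,y,z⟧/(z^2 + x^3 + y^5) (the rational double point of type E_8^0 in characteristic 2). Set f_1 := z/(xy) and f_2 := z/(xy^2) in L. With L and A as in the context: (i) f_1^2 ∈ A and f_2^2 ∈ A; (ii) the images of f_1 and f_2 in L/A are k-linearly independent; (iii) for every c ∈ L such that c^{2^m} ∈ A for some m ≥ 0, there exist a_1, a_2 ∈ k with c − a_1·f_1 − a_2·f_2 ∈ A. In other words, for E_8^0 in characteristic 2 the Frobenius-nilpotent part H^2_m(R)[F^∞] is two-dimensional over k, spanned by the classes of z/(xy) and z/(xy^2), both annihilated by Frobenius. -/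
set_option maxHeartbeats 1000000
set_option synthInstance.maxHeartbeats 400000

open MvPowerSeries

noncomputable section

variable (k : Type) [Field k]

/-- The defining equation of the rational double point of type `E_8^0` in characteristic `2`. -/
abbrev fE8p0 : PS k := X 2 ^ 2 + X 0 ^ 3 + X 1 ^ 5

section CechMembership

variable {R : Type*} [CommRing R] (x y : R)

/-- The submodule of `R_{xy}` generated by the images of `R_x` and `R_y`. -/
def cechSubmodule : Submodule R (Localization.Away (x * y)) :=
  Submodule.span R
    (Set.range (IsLocalization.Away.awayToAwayRight (S := Localization.Away x)
        (P := Localization.Away (x * y)) x y) ∪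
      Set.range (IsLocalization.Away.awayToAwayLeft (S := Localization.Away y)
        (P := Localization.Away (x * y)) y x))

variable {x y}

theorem exists_mul_pow_eq_of_mem_cechSubmodule {c : Localization.Away (x * y)}
    (hc : c ∈ cechSubmodule x y) :
    ∃ (N : ℕ) (s t : R), c * algebraMap R _ ((x * y) ^ N) =
      algebraMap R _ (s * x ^ N + t * y ^ N) := by
  induction hc using Submodule.span_induction with
  | mem c hc =>
    rcases hc with ⟨w, rfl⟩ | ⟨w, rfl⟩
    · obtain ⟨N, s, hs⟩ := IsLocalization.Away.surj x w
      refine ⟨N, 0, s, ?_⟩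
      have h := congrArg (IsLocalization.Away.awayToAwayRight
        (P := Localization.Away (x * y)) x y) hs
      rw [map_mul, map_pow, IsLocalization.Away.awayToAwayRight_eq,
        IsLocalization.Away.awayToAwayRight_eq] at h
      simp only [zero_mul, zero_add, map_mul, map_pow, ← h]
      ring
    · obtain ⟨N, s, hs⟩ := IsLocalization.Away.surj y w
      refine ⟨N, s, 0, ?_⟩
      have h := congrArg (IsLocalization.Away.awayToAwayLeft
        (P := Localization.Away (x * y)) y x) hs
      rw [map_mul, map_pow, IsLocalization.Away.awayToAwayLeft_eq,
        IsLocalization.Away.awayToAwayLeft_eq] at h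
      simp only [zero_mul, add_zero, map_mul, map_pow, ← h]
      ring
  | zero => exact ⟨0, 0, 0, by simp⟩
  | add c d _ _ hc hd =>
    obtain ⟨N, s, t, h⟩ := hc
    obtain ⟨M, s', t', h'⟩ := hd
    refine ⟨N + M, s * y ^ M + s' * y ^ N, t * x ^ M + t' * x ^ N, ?_⟩
    rw [add_mul, pow_add, map_mul, ← mul_assoc, h, mul_comm (algebraMap R _ ((x * y) ^ N)),
      ← mul_assoc, h', ← map_mul, ← map_mul, ← map_add]
    congr 1
    ring
  | smul a c _ hc =>
    obtain ⟨N, s, t, h⟩ := hc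
    refine ⟨N, a * s, a * t, ?_⟩
    rw [Algebra.smul_def, mul_assoc, h, ← map_mul]
    congr 1
    ring

theorem exists_pow_mul_eq_of_mem_cechSubmodule {c : Localization.Away (x * y)} {n : ℕ} {r : R}
    (hr : c * algebraMap R _ ((x * y) ^ n) = algebraMap R _ r) (hc : c ∈ cechSubmodule x y) :
    ∃ (N : ℕ) (s t : R), (x * y) ^ N * r = s * x ^ (n + N) + t * y ^ (n + N) := by
  obtain ⟨N, s, t, h⟩ := exists_mul_pow_eq_of_mem_cechSubmodule hc
  have key : algebraMap R (Localization.Away (x * y)) ((x * y) ^ N * r) =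
      algebraMap R _ ((x * y) ^ n * (s * x ^ N + t * y ^ N)) := by
    rw [map_mul, map_mul, ← hr, ← h]
    ring
  obtain ⟨⟨_, M, rfl⟩, hM⟩ := (IsLocalization.eq_iff_exists (Submonoid.powers (x * y)) _).mp key
  refine ⟨M + N, s * y ^ (n + M), t * x ^ (n + M), ?_⟩
  have hM' : (x * y) ^ M * ((x * y) ^ N * r) =
    (x * y) ^ M * ((x * y) ^ n * (s * x ^ N + t * y ^ N)) := hM
  rw [pow_add, mul_assoc, hM']
  ring

theorem mem_cechSubmodule_of_mul_pow_eq {c : Localization.Away (x * y)} {n : ℕ} {s t : R}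
    (h : c * algebraMap R _ ((x * y) ^ n) = algebraMap R _ (s * x ^ n + t * y ^ n)) :
    c ∈ cechSubmodule x y := by
  have hx := IsLocalization.Away.mul_invSelf (S := Localization.Away x) x
  have hy := IsLocalization.Away.mul_invSelf (S := Localization.Away y) y
  set u := IsLocalization.Away.awayToAwayRight (P := Localization.Away (x * y)) x y
    (IsLocalization.Away.invSelf (S := Localization.Away x) x) with hu
  set v := IsLocalization.Away.awayToAwayLeft (P := Localization.Away (x * y)) y x
    (IsLocalization.Away.invSelf (S := Localization.Away y) y) with hv
  have hxu : algebraMap R (Localization.Away (x * y)) x * u = 1 := by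
    rw [hu, ← IsLocalization.Away.awayToAwayRight_eq (S := Localization.Away x) x y x,
      ← map_mul, hx, map_one]
  have hyv : algebraMap R (Localization.Away (x * y)) y * v = 1 := by
    rw [hv, ← IsLocalization.Away.awayToAwayLeft_eq (S := Localization.Away y) y x y,
      ← map_mul, hy, map_one]
  have hxn := congrArg (· ^ n) hxu
  have hyn := congrArg (· ^ n) hyv
  simp only [mul_pow, one_pow] at hxn hyn
  have hc : c = s • v ^ n + t • u ^ n := by
    simp only [map_pow, map_mul, map_add, mul_pow, Algebra.smul_def] at h ⊢
    linear_combination (u ^ n * v ^ n) * h + (-c * algebraMap R _ y ^ n * v ^ n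
      + algebraMap R _ s * v ^ n) * hxn + (-c + algebraMap R _ t * u ^ n) * hyn
  rw [hc]
  refine add_mem (Submodule.smul_mem _ _ (Submodule.subset_span (Or.inr ⟨_, map_pow _ _ n⟩)))
    (Submodule.smul_mem _ _ (Submodule.subset_span (Or.inl ⟨_, map_pow _ _ n⟩)))

end CechMembership

section PowerSeries

variable {k}

/-- The exponent vector of the monomial `x^i y^j z^e`. -/
def triple (i j e : ℕ) : Fin 3 →₀ ℕ :=
  Finsupp.single 0 i + Finsupp.single 1 j + Finsupp.single 2 e

theorem triple_inj {i j e i' j' e' : ℕ} :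
    triple i j e = triple i' j' e' ↔ i = i' ∧ j = j' ∧ e = e' := by
  refine ⟨fun h => ?_, by rintro ⟨rfl, rfl, rfl⟩; rfl⟩
  have h0 := DFunLike.congr_fun h 0
  have h1 := DFunLike.congr_fun h 1
  have h2 := DFunLike.congr_fun h 2
  simp [triple] at h0 h1 h2
  exact ⟨h0, h1, h2⟩

theorem eq_triple (d : Fin 3 →₀ ℕ) : d = triple (d 0) (d 1) (d 2) := by
  ext i
  fin_cases i <;> simp [triple]

theorem X_pow_mul_eq_monomial (i j e : ℕ) :
    (X 0 ^ i * X 1 ^ j * X 2 ^ e : PS k) = monomial (triple i j e) 1 := by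
  simp only [X_pow_eq, monomial_mul_monomial, triple, one_mul]

theorem coeff_triple_X_pow_mul (i j e i' j' e' : ℕ) :
    coeff (triple i' j' e') (X 0 ^ i * X 1 ^ j * X 2 ^ e : PS k) =
      if i' = i ∧ j' = j ∧ e' = e then 1 else 0 := by
  classical
  rw [X_pow_mul_eq_monomial, coeff_monomial]
  simp only [triple_inj]

theorem coeff_triple_add_mul (i j e i' j' : ℕ) (r : PS k) :
    coeff (triple (i' + i) (j' + j) e) (X 0 ^ i' * X 1 ^ j' * r) = coeff (triple i j e) r := by
  have h : triple (i' + i) (j' + j) e = triple i' j' 0 + triple i j e := by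
    ext l
    fin_cases l <;> simp [triple]
  have h' : (X 0 ^ i' * X 1 ^ j' : PS k) = monomial (triple i' j' 0) 1 := by
    rw [← X_pow_mul_eq_monomial, pow_zero, mul_one]
  rw [h, h', coeff_add_monomial_mul, one_mul]

theorem coeff_triple_eq_zero {A B C i j e : ℕ} (hi : i < A) (hj : j < B) (he : e < C)
    (s t w : PS k) :
    coeff (triple i j e) (s * X 0 ^ A + t * X 1 ^ B + w * X 2 ^ C) = 0 := by
  have h0 := X_pow_dvd_iff.mp (Dvd.intro_left s (rfl : s * X 0 ^ A = _)) (triple i j e)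
    (by simpa [triple] using hi)
  have h1 := X_pow_dvd_iff.mp (Dvd.intro_left t (rfl : t * X 1 ^ B = _)) (triple i j e)
    (by simpa [triple] using hj)
  have h2 := X_pow_dvd_iff.mp (Dvd.intro_left w (rfl : w * X 2 ^ C = _)) (triple i j e)
    (by simpa [triple] using he)
  rw [map_add, map_add, h0, h1, h2, add_zero, add_zero]

theorem exists_eq_of_coeff_eq_zero {A B C : ℕ} {r : PS k}
    (h : ∀ d : Fin 3 →₀ ℕ, d 0 < A → d 1 < B → d 2 < C → coeff d r = 0) :
    ∃ s t w : PS k, r = s * X 0 ^ A + t * X 1 ^ B + w * X 2 ^ C := by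
  classical
  let r₀ : PS k := fun d => if A ≤ d 0 then coeff d r else 0
  let r₁ : PS k := fun d => if d 0 < A ∧ B ≤ d 1 then coeff d r else 0
  let r₂ : PS k := fun d => if d 0 < A ∧ d 1 < B then coeff d r else 0
  have h₀ : X 0 ^ A ∣ r₀ := X_pow_dvd_iff.mpr fun d hd => if_neg (by omega)
  have h₁ : X 1 ^ B ∣ r₁ := X_pow_dvd_iff.mpr fun d hd => if_neg (by omega)
  have h₂ : X 2 ^ C ∣ r₂ := X_pow_dvd_iff.mpr fun d hd => by
    change (if d 0 < A ∧ d 1 < B then coeff d r else 0) = 0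
    split_ifs with h'
    · exact h d h'.1 h'.2 hd
    · rfl
  have hr : r = r₀ + r₁ + r₂ := by
    ext d
    change coeff d r = (if A ≤ d 0 then coeff d r else 0) +
      (if d 0 < A ∧ B ≤ d 1 then coeff d r else 0) +
      (if d 0 < A ∧ d 1 < B then coeff d r else 0)
    by_cases ha : A ≤ d 0
    · simp [ha, not_lt.mpr ha]
    · by_cases hb : B ≤ d 1
      · simp [ha, not_le.mp ha, hb, not_lt.mpr hb]
      · simp [ha, not_le.mp ha, hb, not_le.mp hb]
  obtain ⟨s, hs⟩ := h₀
  obtain ⟨t, ht⟩ := h₁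
  obtain ⟨w, hw⟩ := h₂
  exact ⟨s, t, w, by rw [hr, hs, ht, hw]; ring⟩

theorem coeff_smul_pow_two_pow [CharP k 2] (d : Fin 3 →₀ ℕ) (m : ℕ) (r : PS k) :
    coeff (2 ^ m • d) (r ^ 2 ^ m) = coeff d r ^ 2 ^ m := by
  have : ExpChar k 2 := ExpChar.prime Nat.prime_two
  rw [← map_iterateFrobenius_expand 2 two_ne_zero r m, coeff_map, coeff_expand_smul,
    iterateFrobenius_def]

/-- The ideal `(x^n, y^n, z^2 + x^3 + y^5)` of `k⟦x,y,z⟧`. -/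
def powIdeal (k : Type) [Field k] (n : ℕ) : Ideal (PS k) :=
  Ideal.span {X 0 ^ n, X 1 ^ n, fE8p0 k}

theorem mem_powIdeal {n : ℕ} {r : PS k} :
    r ∈ powIdeal k n ↔ ∃ s t w : PS k, r = s * X 0 ^ n + t * X 1 ^ n + w * fE8p0 k := by
  rw [powIdeal, Ideal.mem_span_insert]
  simp only [Ideal.mem_span_pair]
  constructor
  · rintro ⟨s, _, ⟨t, w, rfl⟩, rfl⟩
    exact ⟨s, t, w, by ring⟩
  · rintro ⟨s, t, w, rfl⟩
    exact ⟨s, _, ⟨t, w, rfl⟩, by ring⟩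

theorem mem_powIdeal_iff_mk {n : ℕ} {r : PS k} :
    r ∈ powIdeal k n ↔ ∃ s t : Rq k (fE8p0 k), Ideal.Quotient.mk _ r =
      s * xR k (fE8p0 k) ^ n + t * yR k (fE8p0 k) ^ n := by
  rw [mem_powIdeal]
  constructor
  · rintro ⟨s, t, w, rfl⟩
    refine ⟨Ideal.Quotient.mk _ s, Ideal.Quotient.mk _ t, ?_⟩
    rw [← map_pow, ← map_pow, ← map_mul, ← map_mul, ← map_add, Ideal.Quotient.mk_eq_mk_iff_sub_mem,
      add_sub_cancel_left]
    exact Ideal.mul_mem_left _ _ (Ideal.mem_span_singleton_self _)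
  · rintro ⟨s, t, h⟩
    obtain ⟨s, rfl⟩ := Ideal.Quotient.mk_surjective s
    obtain ⟨t, rfl⟩ := Ideal.Quotient.mk_surjective t
    rw [← map_pow, ← map_pow, ← map_mul, ← map_mul, ← map_add, Ideal.Quotient.mk_eq_mk_iff_sub_mem,
      Ideal.mem_span_singleton'] at h
    obtain ⟨w, hw⟩ := h
    exact ⟨s, t, w, by rw [hw]; ring⟩

/-- The `k`-span of the ideal `(x^n, y^n, z^2 + x^3 + y^5)` and the monomials `x^i y^j z^e` with
`i, j < n` and `e < 2`. -/
def monomialSpan (k : Type) [Field k] (n : ℕ) : Submodule k (PS k) :=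
  (powIdeal k n).restrictScalars k ⊔ Submodule.span k
    (Set.range fun t : Fin n × Fin n × Fin 2 =>
      (X 0 ^ (t.1 : ℕ) * X 1 ^ (t.2.1 : ℕ) * X 2 ^ (t.2.2 : ℕ) : PS k))

theorem mem_monomialSpan_of_mem_powIdeal {n : ℕ} {r : PS k} (h : r ∈ powIdeal k n) :
    r ∈ monomialSpan k n :=
  Submodule.mem_sup_left h

theorem X_pow_mul_mem_monomialSpan (n e : ℕ) :
    ∀ i j, (X 0 ^ i * X 1 ^ j * X 2 ^ e : PS k) ∈ monomialSpan k n := by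
  induction e using Nat.strong_induction_on with
  | _ e ih =>
    intro i j
    rcases Nat.lt_or_ge e 2 with he | he
    · rcases Nat.lt_or_ge i n with hi | hi
      · rcases Nat.lt_or_ge j n with hj | hj
        · exact Submodule.mem_sup_right
            (Submodule.subset_span ⟨(⟨i, hi⟩, ⟨j, hj⟩, ⟨e, he⟩), rfl⟩)
        · obtain ⟨l, rfl⟩ := Nat.exists_eq_add_of_le hj
          exact mem_monomialSpan_of_mem_powIdeal
            (mem_powIdeal.mpr ⟨0, X 0 ^ i * X 1 ^ l * X 2 ^ e, 0, by ring⟩)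
      · obtain ⟨l, rfl⟩ := Nat.exists_eq_add_of_le hi
        exact mem_monomialSpan_of_mem_powIdeal
          (mem_powIdeal.mpr ⟨X 0 ^ l * X 1 ^ j * X 2 ^ e, 0, 0, by ring⟩)
    · obtain ⟨l, rfl⟩ := Nat.exists_eq_add_of_le he
      have h : (X 0 ^ i * X 1 ^ j * X 2 ^ (2 + l) : PS k) =
          X 0 ^ i * X 1 ^ j * X 2 ^ l * fE8p0 k -
            (X 0 ^ (i + 3) * X 1 ^ j * X 2 ^ l + X 0 ^ i * X 1 ^ (j + 5) * X 2 ^ l) := by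
        ring
      rw [h]
      refine sub_mem (mem_monomialSpan_of_mem_powIdeal
        (mem_powIdeal.mpr ⟨0, 0, X 0 ^ i * X 1 ^ j * X 2 ^ l, by ring⟩))
        (add_mem (ih l (by omega) _ _) (ih l (by omega) _ _))

theorem X_two_pow_mem_powIdeal (n : ℕ) : (X 2 ^ (4 * n) : PS k) ∈ powIdeal k n := by
  have hz : Ideal.Quotient.mk (powIdeal k n) (X 2 ^ 2) =
      Ideal.Quotient.mk (powIdeal k n) (-X 0 ^ 3) + Ideal.Quotient.mk (powIdeal k n) (-X 1 ^ 5) := by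
    rw [← map_add, Ideal.Quotient.mk_eq_mk_iff_sub_mem]
    exact mem_powIdeal.mpr ⟨0, 0, 1, by ring⟩
  have hx : Ideal.Quotient.mk (powIdeal k n) (-X 0 ^ 3) ^ n = 0 := by
    rw [← map_pow, Ideal.Quotient.eq_zero_iff_mem]
    exact mem_powIdeal.mpr ⟨(-X 0 ^ 2) ^ n, 0, 0, by rw [← mul_pow]; ring⟩
  have hy : Ideal.Quotient.mk (powIdeal k n) (-X 1 ^ 5) ^ n = 0 := by
    rw [← map_pow, Ideal.Quotient.eq_zero_iff_mem]
    exact mem_powIdeal.mpr ⟨0, (-X 1 ^ 4) ^ n, 0, by rw [← mul_pow]; ring⟩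
  rw [← Ideal.Quotient.eq_zero_iff_mem, show 4 * n = 2 * (n + n) by ring, pow_mul, map_pow, hz]
  exact (Commute.all _ _).add_pow_eq_zero_of_add_le_succ_of_pow_eq_zero hx hy (by omega)

theorem mem_monomialSpan (n : ℕ) (r : PS k) : r ∈ monomialSpan k n := by
  classical
  let s : Finset (ℕ × ℕ × ℕ) := Finset.range n ×ˢ Finset.range n ×ˢ Finset.range (4 * n)
  let p : PS k := ∑ t ∈ s, coeff (triple t.1 t.2.1 t.2.2) r •
    (X 0 ^ t.1 * X 1 ^ t.2.1 * X 2 ^ t.2.2)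
  have hp : p ∈ monomialSpan k n := Submodule.sum_mem _ fun t _ =>
    Submodule.smul_mem _ _ (X_pow_mul_mem_monomialSpan n _ _ _)
  obtain ⟨a, b, c, h⟩ := exists_eq_of_coeff_eq_zero (A := n) (B := n) (C := 4 * n) (r := r - p) (by
    intro d h0 h1 h2
    rw [eq_triple d, map_sub, map_sum, Finset.sum_eq_single (d 0, d 1, d 2)]
    · rw [map_smul, coeff_triple_X_pow_mul]
      simp
    · rintro ⟨i, j, e⟩ _ hne
      rw [map_smul, coeff_triple_X_pow_mul, if_neg, smul_zero]
      rintro ⟨rfl, rfl, rfl⟩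
      exact hne rfl
    · intro hs
      simp [s, h0, h1] at hs
      omega)
  rw [← sub_add_cancel r p]
  refine add_mem (mem_monomialSpan_of_mem_powIdeal ?_) hp
  rw [h]
  exact add_mem (mem_powIdeal.mpr ⟨a, b, 0, by ring⟩)
    (Ideal.mul_mem_left _ _ (X_two_pow_mem_powIdeal n))

theorem exists_sub_sum_mem_powIdeal (n : ℕ) (r : PS k) :
    ∃ c : Fin n × Fin n × Fin 2 → k, r - ∑ t, c t •
      (X 0 ^ (t.1 : ℕ) * X 1 ^ (t.2.1 : ℕ) * X 2 ^ (t.2.2 : ℕ) : PS k) ∈ powIdeal k n := by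
  obtain ⟨u, hu, v, hv, rfl⟩ := Submodule.mem_sup.mp (mem_monomialSpan n r)
  obtain ⟨c, rfl⟩ := (Submodule.mem_span_range_iff_exists_fun k).mp hv
  exact ⟨c, by simpa using hu⟩

theorem hasSubst_sqrt :
    HasSubst (![X 0 ^ 2, X 1 ^ 2, X 0 ^ 3 + X 1 ^ 5 + X 2] : Fin 3 → PS k) := by
  refine hasSubst_of_constantCoeff_zero fun i => ?_
  fin_cases i <;> simp

/-- The endomorphism `x ↦ x^2`, `y ↦ y^2`, `z ↦ x^3 + y^5 + z` of `k⟦x,y,z⟧`, which in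
characteristic `2` sends `z^2 + x^3 + y^5` to `z^2`. -/
def sqrtHom (k : Type) [Field k] : PS k →ₐ[k] PS k :=
  substAlgHom (hasSubst_sqrt (k := k))

theorem sqrtHom_X_zero : sqrtHom k (X 0) = X 0 ^ 2 :=
  substAlgHom_X hasSubst_sqrt 0

theorem sqrtHom_X_one : sqrtHom k (X 1) = X 1 ^ 2 :=
  substAlgHom_X hasSubst_sqrt 1

theorem sqrtHom_X_two : sqrtHom k (X 2) = X 0 ^ 3 + X 1 ^ 5 + X 2 :=
  substAlgHom_X hasSubst_sqrt 2

theorem sqrtHom_fE8p0 [CharP k 2] : sqrtHom k (fE8p0 k) = X 2 ^ 2 := by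
  have h2 : (2 : PS k) = 0 := by
    rw [← map_ofNat (C (σ := Fin 3) (R := k)) 2, CharTwo.two_eq_zero, map_zero]
  rw [map_add, map_add, map_pow, map_pow, map_pow, sqrtHom_X_zero, sqrtHom_X_one, sqrtHom_X_two]
  linear_combination (X 0 ^ 6 + X 1 ^ 10 + X 0 ^ 3 * X 1 ^ 5 + X 0 ^ 3 * X 2 + X 1 ^ 5 * X 2) * h2

theorem coeff_sqrtHom_eq_zero [CharP k 2] {n i j e : ℕ} {r : PS k} (hr : r ∈ powIdeal k n)
    (hi : i < 2 * n) (hj : j < 2 * n) (he : e < 2) :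
    coeff (triple i j e) (sqrtHom k r) = 0 := by
  obtain ⟨s, t, w, rfl⟩ := mem_powIdeal.mp hr
  rw [map_add (sqrtHom k), map_add (sqrtHom k), map_mul (sqrtHom k), map_mul (sqrtHom k),
    map_mul (sqrtHom k), map_pow (sqrtHom k), map_pow (sqrtHom k), sqrtHom_fE8p0,
    sqrtHom_X_zero, sqrtHom_X_one, ← pow_mul, ← pow_mul]
  exact coeff_triple_eq_zero hi hj he _ _ _

theorem coeff_sqrtHom_X_pow_mul (i j i' j' e' : ℕ) :
    coeff (triple i' j' e') (sqrtHom k (X 0 ^ i * X 1 ^ j)) =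
      if i' = 2 * i ∧ j' = 2 * j ∧ e' = 0 then 1 else 0 := by
  rw [map_mul (sqrtHom k), map_pow, map_pow, sqrtHom_X_zero, sqrtHom_X_one, ← pow_mul, ← pow_mul,
    ← coeff_triple_X_pow_mul, pow_zero, mul_one]

theorem coeff_sqrtHom_X_pow_mul_X_two (i j i' j' e' : ℕ) :
    coeff (triple i' j' e') (sqrtHom k (X 0 ^ i * X 1 ^ j * X 2)) =
      (if i' = 2 * i + 3 ∧ j' = 2 * j ∧ e' = 0 then 1 else 0) +
      (if i' = 2 * i ∧ j' = 2 * j + 5 ∧ e' = 0 then 1 else 0) +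
      (if i' = 2 * i ∧ j' = 2 * j ∧ e' = 1 then 1 else 0) := by
  rw [← coeff_triple_X_pow_mul, ← coeff_triple_X_pow_mul, ← coeff_triple_X_pow_mul, ← map_add,
    ← map_add, map_mul (sqrtHom k), map_mul (sqrtHom k), map_pow, map_pow, sqrtHom_X_zero, sqrtHom_X_one, sqrtHom_X_two]
  congr 1
  ring

/-- If `(xy)^N r^q` lies in the ideal `(x^(nq+N), y^(nq+N), f)` for a power `q` of `2`, then the
low order coefficients of the image of `r` in `k⟦√x, √y⟧` vanish. -/
theorem coeff_sqrtHom_eq_zero_of_pow [CharP k 2] {n N m i j : ℕ} {r : PS k}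
    (h : (X 0 * X 1) ^ N * r ^ 2 ^ m ∈ powIdeal k (n * 2 ^ m + N))
    (hi : i < 2 * n) (hj : j < 2 * n) : coeff (triple i j 0) (sqrtHom k r) = 0 := by
  have hq : 0 < 2 ^ m := by positivity
  have key := coeff_sqrtHom_eq_zero (i := 2 * N + 2 ^ m * i) (j := 2 * N + 2 ^ m * j) h
    (by nlinarith) (by nlinarith) zero_lt_two
  have hs : triple (2 ^ m * i) (2 ^ m * j) 0 = 2 ^ m • triple i j 0 := by
    ext l
    fin_cases l <;> simp [triple]
  rw [map_mul (sqrtHom k), map_pow (sqrtHom k), map_pow, map_mul (sqrtHom k),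
    sqrtHom_X_zero, sqrtHom_X_one, mul_pow, ← pow_mul,
    ← pow_mul, coeff_triple_add_mul, hs, coeff_smul_pow_two_pow] at key
  exact eq_zero_of_pow_eq_zero key

/-- A combination of the monomials `x^i y^j z^e` with `i, j < n + 2`, `e < 2` whose image in
`k⟦√x, √y⟧` has vanishing low order coefficients only involves the two monomials
`x^(n+1) y^(n+1) z` and `x^(n+1) y^n z`. -/
theorem exists_sum_smul_eq {n : ℕ} (c : Fin (n + 2) × Fin (n + 2) × Fin 2 → k)
    (h : ∀ i j, i < 2 * (n + 2) → j < 2 * (n + 2) → coeff (triple i j 0) (sqrtHom k (∑ t, c t •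
      (X 0 ^ (t.1 : ℕ) * X 1 ^ (t.2.1 : ℕ) * X 2 ^ (t.2.2 : ℕ) : PS k))) = 0) :
    ∃ a₁ a₂ : k, ∑ t, c t •
      (X 0 ^ (t.1 : ℕ) * X 1 ^ (t.2.1 : ℕ) * X 2 ^ (t.2.2 : ℕ) : PS k) =
        a₁ • (X 0 ^ (n + 1) * X 1 ^ (n + 1) * X 2) + a₂ • (X 0 ^ (n + 1) * X 1 ^ n * X 2) := by
  have hcoeff : ∀ i j, coeff (triple i j 0) (sqrtHom k (∑ t, c t •
      (X 0 ^ (t.1 : ℕ) * X 1 ^ (t.2.1 : ℕ) * X 2 ^ (t.2.2 : ℕ) : PS k))) =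
      ∑ t : Fin (n + 2) × Fin (n + 2), (c (t.1, t.2, 0) *
          (if i = 2 * (t.1 : ℕ) ∧ j = 2 * (t.2 : ℕ) then 1 else 0) + c (t.1, t.2, 1) *
          ((if i = 2 * (t.1 : ℕ) + 3 ∧ j = 2 * (t.2 : ℕ) then 1 else 0) +
          (if i = 2 * (t.1 : ℕ) ∧ j = 2 * (t.2 : ℕ) + 5 then 1 else 0))) := by
    intro i j
    rw [Fintype.sum_prod_type, Fintype.sum_prod_type, map_sum, map_sum]
    refine Finset.sum_congr rfl fun a _ => ?_
    rw [Fintype.sum_prod_type, map_sum, map_sum]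
    refine Finset.sum_congr rfl fun b _ => ?_
    rw [Fin.sum_univ_two, map_add, map_add, map_smul, map_smul, map_smul, map_smul]
    simp only [Fin.val_zero, Fin.val_one, pow_zero, pow_one, mul_one, coeff_sqrtHom_X_pow_mul,
      coeff_sqrtHom_X_pow_mul_X_two, smul_eq_mul]
    simp
  simp only [hcoeff] at h
  have h0 : ∀ a b : Fin (n + 2), c (a, b, 0) = 0 := by
    intro a b
    have := h (2 * a) (2 * b) (by omega) (by omega)
    rw [Finset.sum_eq_single (a, b)] at this
    · rw [if_pos (by simp), if_neg (by simp), if_neg (by simp)] at this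
      simpa using this
    · rintro ⟨a', b'⟩ _ hne
      rw [if_neg, if_neg, if_neg]
      · simp
      · simp; omega
      · simp; omega
      · rintro ⟨h1, h2⟩
        exact hne (Prod.ext (Fin.ext (by dsimp only at h1 ⊢; omega))
          (Fin.ext (by dsimp only at h2 ⊢; omega)))
    · simp
  have h1 : ∀ a b : Fin (n + 2), (a : ℕ) < n + 1 → c (a, b, 1) = 0 := by
    intro a b ha
    have := h (2 * a + 3) (2 * b) (by omega) (by omega)
    rw [Finset.sum_eq_single (a, b)] at this
    · simpa [h0] using this
    · rintro ⟨a', b'⟩ _ hne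
      rw [h0, zero_mul, zero_add, if_neg, if_neg]
      · simp
      · simp; omega
      · rintro ⟨h1, h2⟩
        exact hne (Prod.ext (Fin.ext (by dsimp only at h1 ⊢; omega))
          (Fin.ext (by dsimp only at h2 ⊢; omega)))
    · simp
  have h2 : ∀ a b : Fin (n + 2), (b : ℕ) < n → c (a, b, 1) = 0 := by
    intro a b ha
    have := h (2 * a) (2 * b + 5) (by omega) (by omega)
    rw [Finset.sum_eq_single (a, b)] at this
    · simpa [h0] using this
    · rintro ⟨a', b'⟩ _ hne
      rw [h0, zero_mul, zero_add, if_neg, if_neg]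
      · simp
      · rintro ⟨h1, h2⟩
        exact hne (Prod.ext (Fin.ext (by dsimp only at h1 ⊢; omega))
          (Fin.ext (by dsimp only at h2 ⊢; omega)))
      · simp; omega
    · simp
  let u : Fin (n + 2) := ⟨n + 1, by omega⟩
  let v : Fin (n + 2) := ⟨n, by omega⟩
  refine ⟨c (u, u, 1), c (u, v, 1), ?_⟩
  rw [Finset.sum_eq_add (u, u, 1) (u, v, 1)]
  · simp [u, v]
  · simp [u, v]
  · rintro ⟨a, b, e⟩ _ ⟨hne, hne'⟩
    suffices hz : c (a, b, e) = 0 by rw [hz, zero_smul]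
    fin_cases e
    · exact h0 a b
    · by_cases ha : (a : ℕ) < n + 1
      · exact h1 a b ha
      · by_cases hb : (b : ℕ) < n
        · exact h2 a b hb
        · have hau : a = u := Fin.ext (by simp [u]; omega)
          have hbuv : b = u ∨ b = v := by
            simp only [u, v, Fin.ext_iff]
            omega
          rcases hbuv with rfl | rfl <;> simp_all
  · simp
  · simp

end PowerSeries

section E8

variable {k}

theorem fcls_mul (f : PS k) (j : ℕ) :
    fcls k f j * algebraMap _ (Lloc k f) ((xR k f * yR k f) ^ j) =
      algebraMap _ (Lloc k f) (zR k f * xR k f ^ (j - 1)) := by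
  rw [fcls, Localization.mk_eq_mk']
  exact IsLocalization.mk'_spec _ _ _

theorem mem_Asub_of_mem_powIdeal {c : Lloc k (fE8p0 k)} {n : ℕ} {r : PS k}
    (h : c * algebraMap (Rq k (fE8p0 k)) _ ((xR k (fE8p0 k) * yR k (fE8p0 k)) ^ n) =
      algebraMap (Rq k (fE8p0 k)) _ (Ideal.Quotient.mk _ r)) (hr : r ∈ powIdeal k n) :
    c ∈ Asub k (fE8p0 k) := by
  obtain ⟨s, t, hst⟩ := mem_powIdeal_iff_mk.mp hr
  rw [hst] at h
  exact mem_cechSubmodule_of_mul_pow_eq h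

theorem exists_mem_powIdeal_of_mem_Asub {c : Lloc k (fE8p0 k)} {n : ℕ} {r : PS k}
    (h : c * algebraMap (Rq k (fE8p0 k)) _ ((xR k (fE8p0 k) * yR k (fE8p0 k)) ^ n) =
      algebraMap (Rq k (fE8p0 k)) _ (Ideal.Quotient.mk _ r)) (hc : c ∈ Asub k (fE8p0 k)) :
    ∃ N, (X 0 * X 1) ^ N * r ∈ powIdeal k (n + N) := by
  obtain ⟨N, s, t, hst⟩ := exists_pow_mul_eq_of_mem_cechSubmodule h hc
  refine ⟨N, mem_powIdeal_iff_mk.mpr ⟨s, t, ?_⟩⟩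
  rw [← hst]
  simp only [map_mul, map_pow]

theorem smul_add_smul_mul_eq (n : ℕ) (a₁ a₂ : k) :
    (algebraMap k (Rq k (fE8p0 k)) a₁ • fcls k (fE8p0 k) 1 +
      algebraMap k (Rq k (fE8p0 k)) a₂ • fcls k (fE8p0 k) 2) *
        algebraMap (Rq k (fE8p0 k)) _ ((xR k (fE8p0 k) * yR k (fE8p0 k)) ^ (n + 2)) =
      algebraMap (Rq k (fE8p0 k)) _ (Ideal.Quotient.mk _
        (a₁ • (X 0 ^ (n + 1) * X 1 ^ (n + 1) * X 2) + a₂ • (X 0 ^ (n + 1) * X 1 ^ n * X 2))) := by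
  have h1 := fcls_mul (fE8p0 k) 1
  have h2 := fcls_mul (fE8p0 k) 2
  have hC : ∀ a : k, Ideal.Quotient.mk (Ideal.span {fE8p0 k}) (algebraMap k (PS k) a) =
    algebraMap k (Rq k (fE8p0 k)) a := fun _ => rfl
  have hs : ∀ (r : Rq k (fE8p0 k)) (g : Lloc k (fE8p0 k)), r • g = algebraMap _ _ r * g :=
    fun r g => Algebra.smul_def r g
  simp only [hs, Algebra.smul_def, hC, map_add, map_mul, map_pow, pow_one, Nat.sub_self,
    pow_zero, mul_one, Nat.add_one_sub_one] at h1 h2 ⊢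
  generalize fcls k (fE8p0 k) 1 = f₁ at *
  generalize fcls k (fE8p0 k) 2 = f₂ at *
  generalize algebraMap (Rq k (fE8p0 k)) (Lloc k (fE8p0 k)) (Ideal.Quotient.mk _ (X 0)) = x at *
  generalize algebraMap (Rq k (fE8p0 k)) (Lloc k (fE8p0 k)) (Ideal.Quotient.mk _ (X 1)) = y at *
  generalize algebraMap (Rq k (fE8p0 k)) (Lloc k (fE8p0 k)) (Ideal.Quotient.mk _ (X 2)) = z at *
  generalize algebraMap (Rq k (fE8p0 k)) (Lloc k (fE8p0 k)) (algebraMap k _ a₁) = b₁ at *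
  generalize algebraMap (Rq k (fE8p0 k)) (Lloc k (fE8p0 k)) (algebraMap k _ a₂) = b₂ at *
  linear_combination (b₁ * (x * y) ^ (n + 1)) * h1 + (b₂ * (x * y) ^ n) * h2

theorem fcls_sq_mem_Asub {j : ℕ} {r : PS k} (hr : (X 2 * X 0 ^ (j - 1)) ^ 2 - r * fE8p0 k ∈
    powIdeal k (j * 2)) : fcls k (fE8p0 k) j ^ 2 ∈ Asub k (fE8p0 k) := by
  refine mem_Asub_of_mem_powIdeal (n := j * 2) (r := (X 2 * X 0 ^ (j - 1)) ^ 2) ?_ ?_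
  · rw [pow_mul, map_pow _ _ 2, ← mul_pow, fcls_mul, ← map_pow]
    simp only [map_mul, map_pow]
  · rw [← sub_add_cancel ((X 2 * X 0 ^ (j - 1)) ^ 2) (r * fE8p0 k)]
    exact add_mem hr (mem_powIdeal.mpr ⟨0, 0, r, by ring⟩)

end E8

/-- For the rational double point `R` of type `E_8^0` in characteristic `2`,
the Frobenius-nilpotent part `H^2_m(R)[F^∞]` of the local cohomology `L/A` is the
two-dimensional `k`-vector space spanned by the classes of `f₁ = z/(xy)` and `f₂ = z/(xy²)`,
both annihilated by Frobenius. -/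
theorem localCohomology_E8p0_char2 (k : Type) [Field k] [IsAlgClosed k] [CharP k 2] :
    -- (i) f₁² ∈ A and f₂² ∈ A
    (fcls k (fE8p0 k) 1) ^ 2 ∈ Asub k (fE8p0 k) ∧
    (fcls k (fE8p0 k) 2) ^ 2 ∈ Asub k (fE8p0 k) ∧
    -- (ii) the images of f₁ and f₂ in L/A are k-linearly independent
    (∀ a₁ a₂ : k,
      algebraMap k (Rq k (fE8p0 k)) a₁ • fcls k (fE8p0 k) 1 +
        algebraMap k (Rq k (fE8p0 k)) a₂ • fcls k (fE8p0 k) 2 ∈ Asub k (fE8p0 k) →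
      a₁ = 0 ∧ a₂ = 0) ∧
    -- (iii) every Frobenius-nilpotent class is a k-linear combination of f₁ and f₂
    (∀ c : Lloc k (fE8p0 k), (∃ m : ℕ, c ^ 2 ^ m ∈ Asub k (fE8p0 k)) →
      ∃ a₁ a₂ : k,
        c - algebraMap k (Rq k (fE8p0 k)) a₁ • fcls k (fE8p0 k) 1
          - algebraMap k (Rq k (fE8p0 k)) a₂ • fcls k (fE8p0 k) 2 ∈ Asub k (fE8p0 k)) := by
  refine ⟨?_, ?_, fun a₁ a₂ h => ?_, ?_⟩
  · exact fcls_sq_mem_Asub (r := 1) (mem_powIdeal.mpr ⟨-X 0, -X 1 ^ 3, 0, by ring⟩)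
  · exact fcls_sq_mem_Asub (r := X 0 ^ 2) (mem_powIdeal.mpr ⟨-X 0, -(X 0 ^ 2 * X 1), 0, by ring⟩)
  · obtain ⟨N, hN⟩ := exists_mem_powIdeal_of_mem_Asub (smul_add_smul_mul_eq 0 a₁ a₂) h
    have hcoeff : ∀ j, j < 4 → coeff (triple 2 j 1) (sqrtHom k
        (a₁ • (X 0 ^ (0 + 1) * X 1 ^ (0 + 1) * X 2) + a₂ • (X 0 ^ (0 + 1) * X 1 ^ 0 * X 2))) = 0 := by
      intro j hj
      have := coeff_sqrtHom_eq_zero (i := 2 * N + 2) (j := 2 * N + j) (e := 1) hN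
        (by omega) (by omega) one_lt_two
      rwa [map_mul (sqrtHom k), map_pow, map_mul (sqrtHom k), sqrtHom_X_zero, sqrtHom_X_one, mul_pow,
        ← pow_mul, ← pow_mul, coeff_triple_add_mul] at this
    simp only [map_add, map_smul, coeff_sqrtHom_X_pow_mul_X_two] at hcoeff
    exact ⟨by simpa using hcoeff 2 (by norm_num), by simpa using hcoeff 0 (by norm_num)⟩
  · rintro c ⟨m, hm⟩
    obtain ⟨n, r, hr⟩ := IsLocalization.Away.surj (xR k (fE8p0 k) * yR k (fE8p0 k)) c
    obtain ⟨r, rfl⟩ := Ideal.Quotient.mk_surjective r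
    have hc : c * algebraMap (Rq k (fE8p0 k)) _ ((xR k (fE8p0 k) * yR k (fE8p0 k)) ^ (n + 2)) =
        algebraMap (Rq k (fE8p0 k)) _ (Ideal.Quotient.mk _ (r * (X 0 * X 1) ^ 2)) := by
      rw [pow_add, map_mul, ← mul_assoc, map_pow, hr, ← map_mul]
      simp only [map_mul, map_pow]
    have hcm : c ^ 2 ^ m * algebraMap (Rq k (fE8p0 k)) _
        ((xR k (fE8p0 k) * yR k (fE8p0 k)) ^ ((n + 2) * 2 ^ m)) =
        algebraMap (Rq k (fE8p0 k)) _ (Ideal.Quotient.mk _ ((r * (X 0 * X 1) ^ 2) ^ 2 ^ m)) := by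
      rw [pow_mul, map_pow _ _ (2 ^ m), ← mul_pow, hc, ← map_pow, ← map_pow]
    obtain ⟨N, hN⟩ := exists_mem_powIdeal_of_mem_Asub hcm hm
    obtain ⟨b, hb⟩ := exists_sub_sum_mem_powIdeal (n + 2) (r * (X 0 * X 1) ^ 2)
    obtain ⟨a₁, a₂, ha⟩ := exists_sum_smul_eq b fun i j hi hj => by
      have h1 := coeff_sqrtHom_eq_zero_of_pow hN hi hj
      have h2 := coeff_sqrtHom_eq_zero hb hi hj zero_lt_two
      rwa [map_sub, map_sub, h1, zero_sub, neg_eq_zero] at h2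
    rw [ha] at hb
    refine ⟨a₁, a₂, mem_Asub_of_mem_powIdeal ?_ hb⟩
    rw [sub_sub, sub_mul, hc, smul_add_smul_mul_eq, ← map_sub, ← map_sub]
end
end

section
/- Let k be an algebraically closed field of characteristic p = 2 and let R = k⟦x,y,z⟧/(z^2 + x^3 + y^5 + x y^3 z) (the rational double point of type E_8^1 in characteristic 2). Set f_1 := z/(xy) and f_2 := z/(xy^2) in L. With L and A as in the context: (i) f_1^2 ∈ A; (ii) f_2^2 − f_1 ∈ A (so Frobenius sends the class of f_2 to the class of f_1, which is nonzero); (iii) the images of f_1 and f_2 in L/A are k-linearly independent; (iv) for every c ∈ L such that c^{2^m} ∈ A for some m ≥ 0, there exist a_1, a_2 ∈ k with c − a_1·f_1 − a_2·f_2 ∈ A. In other words, H^2_m(R)[F^∞] is two-dimensional over k, spanned by the classes of z/(xy) and z/(xy^2), with F(f_2) = f_1 and F(f_1) = 0. -/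
set_option maxHeartbeats 1000000
set_option synthInstance.maxHeartbeats 400000

open MvPowerSeries

noncomputable section

variable (k : Type) [Field k]

/-- The defining equation of the rational double point of type `E_8^1` in characteristic `2`. -/
abbrev fE8p1 : PS k := X 2 ^ 2 + X 0 ^ 3 + X 1 ^ 5 + X 0 * X 1 ^ 3 * X 2

section PowerSeriesNormalForm

variable {k}

/-- The power series `∑ w i j xⁱ yʲ`, not involving `z`. -/
def planar (w : ℕ → ℕ → k) : PS k := fun e => if e 2 = 0 then w (e 0) (e 1) else 0

lemma coeff_planar (w : ℕ → ℕ → k) (e : Fin 3 →₀ ℕ) :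
    coeff e (planar w) = if e 2 = 0 then w (e 0) (e 1) else 0 := rfl

/-- The coefficients of `xᵃ yᵇ ∑ w i j xⁱ yʲ`. -/
def shiftCoeff (a b : ℕ) (w : ℕ → ℕ → k) : ℕ → ℕ → k :=
  fun i j => if a ≤ i ∧ b ≤ j then w (i - a) (j - b) else 0

/-- In characteristic `2`, the coefficients of `(∑ w i j xⁱ yʲ) ^ 2`. -/
def sqCoeff (w : ℕ → ℕ → k) : ℕ → ℕ → k :=
  fun i j => if 2 ∣ i ∧ 2 ∣ j then w (i / 2) (j / 2) ^ 2 else 0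

lemma planar_zero : planar (0 : ℕ → ℕ → k) = 0 := by
  ext e; simp [coeff_planar]

lemma planar_add (v w : ℕ → ℕ → k) : planar (v + w) = planar v + planar w := by
  ext e; simp only [coeff_planar, map_add, Pi.add_apply]; split_ifs <;> simp

lemma planar_sub (v w : ℕ → ℕ → k) : planar (v - w) = planar v - planar w := by
  ext e; simp only [coeff_planar, map_sub, Pi.sub_apply]; split_ifs <;> simp

lemma monomial_mul_planar (a b : ℕ) (w : ℕ → ℕ → k) :
    X 0 ^ a * X 1 ^ b * planar w = planar (shiftCoeff a b w) := by
  ext e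
  have hle : Finsupp.single (0 : Fin 3) a + Finsupp.single 1 b ≤ e ↔ a ≤ e 0 ∧ b ≤ e 1 := by
    rw [Finsupp.le_def, Fin.forall_fin_succ, Fin.forall_fin_succ]
    simp
  rw [X_pow_eq, X_pow_eq, monomial_mul_monomial, one_mul, coeff_monomial_mul, coeff_planar,
    coeff_planar]
  simp only [hle, shiftCoeff, one_mul]
  split_ifs <;> simp_all

lemma planar_sq [CharP k 2] (w : ℕ → ℕ → k) : planar w ^ 2 = planar (sqCoeff w) := by
  ext e
  rw [← map_frobenius_expand 2 two_ne_zero, coeff_map, coeff_planar]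
  by_cases h : ∀ i, 2 ∣ e i
  · obtain ⟨d, rfl⟩ : ∃ d : Fin 3 →₀ ℕ, e = 2 • d :=
      ⟨e.mapRange (· / 2) rfl, by ext i; simp [Nat.mul_div_cancel' (h i)]⟩
    rw [coeff_expand_smul, coeff_planar]
    simp only [sqCoeff, frobenius_def, Finsupp.smul_apply, smul_eq_mul]
    split_ifs <;> simp_all
  · push Not at h
    obtain ⟨i, hi⟩ := h
    rw [coeff_expand_of_not_dvd 2 two_ne_zero _ hi, map_zero]
    fin_cases i
    · simp_all [sqCoeff]
    · simp_all [sqCoeff]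
    · rw [if_neg]
      rintro h0
      simp_all

/-- For `z`-expansion `g = g₀ + g₁ z + g₂ z² + ⋯`, the series `g₂ + g₃ z + ⋯`. -/
def zzQuot (g : PS k) : PS k := fun e => coeff (e + Finsupp.single 2 2) g

lemma coeff_zzQuot (g : PS k) (e : Fin 3 →₀ ℕ) :
    coeff e (zzQuot g) = coeff (e + Finsupp.single 2 2) g := rfl

lemma zzQuot_add (g h : PS k) : zzQuot (g + h) = zzQuot g + zzQuot h := by
  ext e; simp [coeff_zzQuot]

lemma zzQuot_sq_mul (g : PS k) : zzQuot (X 2 ^ 2 * g) = g := by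
  ext e
  rw [coeff_zzQuot, X_pow_eq, add_comm, coeff_add_monomial_mul, one_mul]

lemma coeff_z_mul (g : PS k) (e : Fin 3 →₀ ℕ) :
    coeff e (X 2 * g) = if e 2 = 0 then 0 else coeff (e - Finsupp.single 2 1) g := by
  have hle : Finsupp.single (2 : Fin 3) 1 ≤ e ↔ 1 ≤ e 2 := by
    rw [Finsupp.single_le_iff]
  rw [X, coeff_monomial_mul]
  simp only [hle, one_mul]
  split_ifs <;> first | rfl | omega

lemma zzQuot_normalForm (u v : ℕ → ℕ → k) : zzQuot (planar u + X 2 * planar v) = 0 := by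
  ext e
  rw [coeff_zzQuot, map_add, coeff_planar, coeff_z_mul, coeff_planar]
  simp

lemma exists_zzQuot (g : PS k) :
    ∃ u v : ℕ → ℕ → k, g = planar u + X 2 * planar v + X 2 ^ 2 * zzQuot g := by
  refine ⟨fun i j => coeff (Finsupp.equivFunOnFinite.symm ![i, j, 0]) g,
    fun i j => coeff (Finsupp.equivFunOnFinite.symm ![i, j, 1]) g, ?_⟩
  ext e
  rw [map_add, map_add, coeff_planar, pow_two, mul_assoc, coeff_z_mul, coeff_z_mul, coeff_z_mul,
    coeff_planar, coeff_zzQuot]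
  rcases h : e 2 with _ | _ | m
  · simp only [if_true, add_zero]
    congr 1; congr 1; ext i; fin_cases i <;> simp [h]
  · simp only [h, Finsupp.tsub_apply, Finsupp.single_eq_same]
    simp
    congr 1; congr 1; ext i; fin_cases i <;> simp [h]
  · simp only [h, Finsupp.tsub_apply, Finsupp.single_eq_same]
    simp
    congr 1; congr 1; ext i; fin_cases i <;> simp [h]

/-- `g` lies in `(xⁿ, yⁿ) + (x, y)ʲ`, expressed through coefficients. -/
def VanishBelow (n j : ℕ) (g : PS k) : Prop :=
  ∀ e : Fin 3 →₀ ℕ, e 0 < n → e 1 < n → e 0 + e 1 < j → coeff e g = 0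

namespace VanishBelow

variable {n j : ℕ} {g h : PS k}

lemma add (hg : VanishBelow n j g) (hh : VanishBelow n j h) : VanishBelow n j (g + h) :=
  fun e h0 h1 h2 => by rw [map_add, hg e h0 h1 h2, hh e h0 h1 h2, add_zero]

lemma neg (hg : VanishBelow n j g) : VanishBelow n j (-g) :=
  fun e h0 h1 h2 => by rw [map_neg, hg e h0 h1 h2, neg_zero]

lemma mul_left (a : PS k) (hg : VanishBelow n j g) : VanishBelow n j (a * g) := by
  intro e h0 h1 h2
  rw [coeff_mul]
  refine Finset.sum_eq_zero fun p hp => ?_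
  rw [Finset.HasAntidiagonal.mem_antidiagonal] at hp
  have e0 : p.1 0 + p.2 0 = e 0 := by rw [← hp]; rfl
  have e1 : p.1 1 + p.2 1 = e 1 := by rw [← hp]; rfl
  rw [hg p.2 (by omega) (by omega) (by omega), mul_zero]

lemma x_mul (hg : VanishBelow n j g) : VanishBelow n (j + 1) (X 0 * g) := by
  intro e h0 h1 h2
  rw [X, coeff_monomial_mul, one_mul]
  split_ifs with hle
  · rw [Finsupp.single_le_iff] at hle
    exact hg _ (by simp; omega) (by simp; omega) (by simp; omega)
  · rfl

lemma y_mul (hg : VanishBelow n j g) : VanishBelow n (j + 1) (X 1 * g) := by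
  intro e h0 h1 h2
  rw [X, coeff_monomial_mul, one_mul]
  split_ifs with hle
  · rw [Finsupp.single_le_iff] at hle
    exact hg _ (by simp; omega) (by simp; omega) (by simp; omega)
  · rfl

lemma zzQuot (hg : VanishBelow n j g) : VanishBelow n j (zzQuot g) := by
  intro e h0 h1 h2
  rw [coeff_zzQuot]
  exact hg _ (by simpa) (by simpa) (by simpa)

lemma tail_mul (hg : VanishBelow n j g) :
    VanishBelow n (j + 1) ((X 0 ^ 3 + X 1 ^ 5 + X 0 * X 1 ^ 3 * X 2) * g) := by
  have h1 := x_mul (mul_left (X 0 ^ 2 + X 1 ^ 3 * X 2) hg)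
  have h2 := y_mul (mul_left (X 1 ^ 4) hg)
  convert h1.add h2 using 1
  ring

end VanishBelow

lemma vanishBelow_iff {n : ℕ} {g : PS k} :
    VanishBelow n (2 * n) g ↔ ∃ s t, g = X 0 ^ n * s + X 1 ^ n * t := by
  constructor
  · intro hg
    let g₁ : PS k := fun e => if e 0 < n then 0 else coeff e g
    have c₁ (e) : coeff e g₁ = if e 0 < n then 0 else coeff e g := rfl
    obtain ⟨s, hs⟩ : X 0 ^ n ∣ g₁ := X_pow_dvd_iff.2 fun e he => by rw [c₁, if_pos he]
    obtain ⟨t, ht⟩ : X 1 ^ n ∣ g - g₁ := X_pow_dvd_iff.2 fun e he => by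
      rw [map_sub, c₁]
      split_ifs with h
      · rw [hg e h he (by omega), sub_zero]
      · exact sub_self _
    exact ⟨s, t, by rw [← hs, ← ht]; ring⟩
  · rintro ⟨s, t, rfl⟩ e h0 h1 -
    rw [map_add, X_pow_dvd_iff.1 (Dvd.intro _ rfl) e h0,
      X_pow_dvd_iff.1 (Dvd.intro _ rfl) e h1, add_zero]

/-- The ideal `(xⁿ, yⁿ, f)` of `k⟦x,y,z⟧`. -/
def frobIdeal (k : Type) [Field k] (n : ℕ) : Ideal (PS k) :=
  Ideal.span {fE8p1 k, X 0 ^ n, X 1 ^ n}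

lemma mem_frobIdeal {n : ℕ} {g : PS k} :
    g ∈ frobIdeal k n ↔ ∃ q s t, g = q * fE8p1 k + X 0 ^ n * s + X 1 ^ n * t := by
  rw [frobIdeal, Ideal.mem_span_insert]
  constructor
  · rintro ⟨q, w, hw, rfl⟩
    obtain ⟨s, t, rfl⟩ := Ideal.mem_span_pair.1 hw
    exact ⟨q, s, t, by ring⟩
  · rintro ⟨q, s, t, rfl⟩
    exact ⟨q, _, Ideal.mem_span_pair.2 ⟨s, t, rfl⟩, by ring⟩

lemma mem_frobIdeal' {n : ℕ} {g : PS k} :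
    g ∈ frobIdeal k n ↔ ∃ q t, g = q * fE8p1 k + t ∧ VanishBelow n (2 * n) t := by
  rw [mem_frobIdeal]
  constructor
  · rintro ⟨q, s, t, rfl⟩
    exact ⟨q, _, add_assoc _ _ _, vanishBelow_iff.2 ⟨s, t, rfl⟩⟩
  · rintro ⟨q, t, rfl, ht⟩
    obtain ⟨s, t, rfl⟩ := vanishBelow_iff.1 ht
    exact ⟨q, s, t, (add_assoc _ _ _).symm⟩

/-- Weierstrass division by `f`, modulo `(xⁿ, yⁿ)`. -/
lemma exists_normalForm (n : ℕ) (g : PS k) :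
    ∃ u v : ℕ → ℕ → k, g - (planar u + X 2 * planar v) ∈ frobIdeal k n := by
  suffices H : ∀ j, ∃ (u v : ℕ → ℕ → k) (q t : PS k),
      g = planar u + X 2 * planar v + q * fE8p1 k + t ∧ VanishBelow n j t by
    obtain ⟨u, v, q, t, rfl, ht⟩ := H (2 * n)
    exact ⟨u, v, mem_frobIdeal'.2 ⟨q, t, by ring, ht⟩⟩
  intro j
  induction j with
  | zero => exact ⟨0, 0, 0, g, by simp [planar_zero], fun _ _ _ h => absurd h (Nat.not_lt_zero _)⟩
  | succ j ih =>
    obtain ⟨u, v, q, t, rfl, ht⟩ := ih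
    obtain ⟨u', v', h⟩ := exists_zzQuot t
    refine ⟨u + u', v + v', q + zzQuot t, _, ?_, ht.zzQuot.tail_mul.neg⟩
    rw [planar_add, planar_add]
    nth_rewrite 1 [h]
    ring

lemma normalForm_coeff_eq_zero {n : ℕ} {u v : ℕ → ℕ → k}
    (h : planar u + X 2 * planar v ∈ frobIdeal k n) {i j : ℕ} (hi : i < n) (hj : j < n) :
    u i j = 0 ∧ v i j = 0 := by
  obtain ⟨q, t, hqt, ht⟩ := mem_frobIdeal'.1 h
  have hq : ∀ m, VanishBelow n m q := by
    intro m
    induction m with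
    | zero => exact fun _ _ _ h => absurd h (Nat.not_lt_zero _)
    | succ m ih =>
      have e1 := zzQuot_normalForm u v
      have e2 : q * fE8p1 k + t =
          X 2 ^ 2 * q + ((X 0 ^ 3 + X 1 ^ 5 + X 0 * X 1 ^ 3 * X 2) * q + t) := by ring
      rw [hqt, e2, zzQuot_add, zzQuot_sq_mul, zzQuot_add, add_eq_zero_iff_eq_neg] at e1
      have ht' : VanishBelow n (m + 1) t := fun e h0 h1 _ => ht e h0 h1 (by omega)
      rw [e1]
      exact (ih.tail_mul.zzQuot.add ht'.zzQuot).neg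
  have key : VanishBelow n (2 * n) (planar u + X 2 * planar v) := by
    rw [hqt, mul_comm q]
    exact ((hq _).mul_left _).add ht
  constructor
  · have := key (Finsupp.equivFunOnFinite.symm ![i, j, 0]) (by simpa) (by simpa) (by simp; omega)
    rw [map_add, coeff_z_mul, coeff_planar] at this
    simpa using this
  · have := key (Finsupp.equivFunOnFinite.symm ![i, j, 1]) (by simpa) (by simpa) (by simp; omega)
    rw [map_add, coeff_z_mul, coeff_planar, coeff_planar] at this
    simpa using this

lemma normalForm_mem {n : ℕ} {u v : ℕ → ℕ → k}
    (h : ∀ i j, i < n → j < n → u i j = 0 ∧ v i j = 0) :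
    planar u + X 2 * planar v ∈ frobIdeal k n := by
  refine mem_frobIdeal'.2 ⟨0, _, by rw [zero_mul, zero_add], ?_⟩
  refine VanishBelow.add ?_ (VanishBelow.mul_left _ ?_) <;> intro e h0 h1 _ <;>
    rw [coeff_planar] <;> simp [h _ _ h0 h1]

/-- Cancellation of `(xy)ᵐ`: the sequence `x, y` is regular on `R`. -/
lemma mem_frobIdeal_of_mul_mem {n m : ℕ} {g : PS k}
    (h : (X 0 * X 1) ^ m * g ∈ frobIdeal k (n + m)) : g ∈ frobIdeal k n := by
  obtain ⟨u, v, huv⟩ := exists_normalForm n g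
  obtain ⟨q, s, t, hq⟩ := mem_frobIdeal.1 huv
  have h' : (X 0 * X 1) ^ m * (g - (planar u + X 2 * planar v)) ∈ frobIdeal k (n + m) :=
    mem_frobIdeal.2 ⟨(X 0 * X 1) ^ m * q, X 1 ^ m * s, X 0 ^ m * t, by rw [hq]; ring⟩
  have h'' : planar (shiftCoeff m m u) + X 2 * planar (shiftCoeff m m v) ∈
      frobIdeal k (n + m) := by
    rw [← monomial_mul_planar, ← monomial_mul_planar]
    convert sub_mem h h' using 1
    ring
  have h0 : planar u + X 2 * planar v ∈ frobIdeal k n := by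
    refine normalForm_mem fun i j hi hj => ?_
    simpa [shiftCoeff] using
      normalForm_coeff_eq_zero h'' (Nat.add_lt_add_right hi m) (Nat.add_lt_add_right hj m)
  simpa using add_mem huv h0

lemma two_eq_zero_PS [CharP k 2] : (2 : PS k) = 0 := by
  rw [← map_ofNat (C (σ := Fin 3) (R := k)) 2, CharTwo.two_eq_zero, map_zero]

lemma normalForm_sq [CharP k 2] (u v : ℕ → ℕ → k) :
    (planar u + X 2 * planar v) ^ 2 = planar (sqCoeff v) * fE8p1 k +
      (planar (sqCoeff u - shiftCoeff 3 0 (sqCoeff v) - shiftCoeff 0 5 (sqCoeff v)) +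
        X 2 * planar (-shiftCoeff 1 3 (sqCoeff v))) := by
  rw [← zero_sub (shiftCoeff 1 3 _), planar_sub, planar_sub, planar_sub, planar_zero,
    ← monomial_mul_planar, ← monomial_mul_planar, ← monomial_mul_planar, ← planar_sq, ← planar_sq]
  linear_combination planar u * X 2 * planar v * two_eq_zero_PS (k := k)

lemma sqCoeff_two_mul (w : ℕ → ℕ → k) (i j : ℕ) :
    sqCoeff w (2 * i) (2 * j) = w i j ^ 2 := by
  simp [sqCoeff]

lemma sqCoeff_of_odd (w : ℕ → ℕ → k) {i j : ℕ} (h : ¬ (2 ∣ i ∧ 2 ∣ j)) :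
    sqCoeff w i j = 0 := if_neg h

lemma shiftCoeff_add (a b : ℕ) (w : ℕ → ℕ → k) (i j : ℕ) :
    shiftCoeff a b w (i + a) (j + b) = w i j := by
  simp [shiftCoeff]

lemma shiftCoeff_eq_zero {a b : ℕ} {w : ℕ → ℕ → k} {i j : ℕ}
    (h : a ≤ i → b ≤ j → w (i - a) (j - b) = 0) : shiftCoeff a b w i j = 0 := by
  rw [shiftCoeff]
  split_ifs with h'
  · exact h h'.1 h'.2
  · rfl

end PowerSeriesNormalForm

section CechCohomology

variable {k}

/-- The fraction `g / (xy)ⁿ ∈ L`. -/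
def cechFrac (n : ℕ) (g : PS k) : Lloc k (fE8p1 k) :=
  Localization.mk (Ideal.Quotient.mk _ g)
    ⟨(xR k (fE8p1 k) * yR k (fE8p1 k)) ^ n, n, rfl⟩

/-- The canonical map `k⟦x,y,z⟧ → L`. -/
def toL (k : Type) [Field k] : PS k →+* Lloc k (fE8p1 k) :=
  (algebraMap (Rq k (fE8p1 k)) (Lloc k (fE8p1 k))).comp (Ideal.Quotient.mk _)

lemma toL_fE8p1 : toL k (fE8p1 k) = 0 := by
  rw [toL, RingHom.comp_apply, Ideal.Quotient.eq_zero_iff_mem.2 (Ideal.mem_span_singleton_self _),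
    map_zero]

lemma isUnit_toL_xy : IsUnit (toL k (X 0 * X 1)) := by
  have := IsLocalization.Away.algebraMap_isUnit (S := Lloc k (fE8p1 k))
    (xR k (fE8p1 k) * yR k (fE8p1 k))
  have h : toL k (X 0 * X 1) =
      algebraMap _ (Lloc k (fE8p1 k)) (xR k (fE8p1 k) * yR k (fE8p1 k)) := by
    rw [toL, RingHom.comp_apply, map_mul (Ideal.Quotient.mk _)]
  exact h ▸ this

lemma mk_smul (a : PS k) (c : Lloc k (fE8p1 k)) :
    Ideal.Quotient.mk (Ideal.span {fE8p1 k}) a • c = toL k a * c :=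
  Algebra.smul_def (R := Rq k (fE8p1 k)) (A := Lloc k (fE8p1 k)) _ _

lemma cechFrac_mul (n : ℕ) (g : PS k) : cechFrac n g * toL k ((X 0 * X 1) ^ n) = toL k g := by
  have := IsLocalization.mk'_spec (Lloc k (fE8p1 k)) (Ideal.Quotient.mk (Ideal.span {fE8p1 k}) g)
    (⟨(xR k (fE8p1 k) * yR k (fE8p1 k)) ^ n, n, rfl⟩ :
      Submonoid.powers (xR k (fE8p1 k) * yR k (fE8p1 k)))
  rw [← Localization.mk_eq_mk'] at this
  simpa [cechFrac, toL] using this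

lemma eq_cechFrac {n : ℕ} {g : PS k} {c : Lloc k (fE8p1 k)}
    (h : c * toL k ((X 0 * X 1) ^ n) = toL k g) : c = cechFrac n g := by
  rw [← cechFrac_mul n g, map_pow] at h
  exact (isUnit_toL_xy.pow n).mul_right_cancel h

lemma exists_cechFrac (c : Lloc k (fE8p1 k)) : ∃ n g, c = cechFrac n g := by
  induction c using Localization.induction_on with
  | H y =>
    obtain ⟨r, s, n, rfl⟩ := y
    obtain ⟨g, rfl⟩ := Ideal.Quotient.mk_surjective r
    exact ⟨n, g, rfl⟩

lemma cechFrac_add_pow (n m : ℕ) (g : PS k) :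
    cechFrac n g = cechFrac (n + m) ((X 0 * X 1) ^ m * g) := by
  refine eq_cechFrac ?_
  rw [pow_add, map_mul, ← mul_assoc, cechFrac_mul, map_mul, mul_comm]

lemma cechFrac_add (n : ℕ) (g h : PS k) : cechFrac n (g + h) = cechFrac n g + cechFrac n h := by
  symm
  refine eq_cechFrac ?_
  rw [add_mul, cechFrac_mul, cechFrac_mul, map_add]

lemma cechFrac_sub (n : ℕ) (g h : PS k) : cechFrac n (g - h) = cechFrac n g - cechFrac n h := by
  symm
  refine eq_cechFrac ?_
  rw [sub_mul, cechFrac_mul, cechFrac_mul, map_sub]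

lemma cechFrac_sq (n : ℕ) (g : PS k) : cechFrac n g ^ 2 = cechFrac (2 * n) (g ^ 2) := by
  refine eq_cechFrac ?_
  rw [mul_comm 2 n, pow_mul, map_pow, ← mul_pow, cechFrac_mul, map_pow]

lemma algebraMap_smul_cechFrac (a : k) (n : ℕ) (g : PS k) :
    algebraMap k (Rq k (fE8p1 k)) a • cechFrac n g = cechFrac n (C a * g) := by
  refine eq_cechFrac ?_
  have ha : algebraMap k (Rq k (fE8p1 k)) a = Ideal.Quotient.mk _ (C a) := rfl
  rw [ha, mk_smul, mul_assoc, cechFrac_mul, map_mul]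

lemma fcls_one : fcls k (fE8p1 k) 1 = cechFrac 1 (X 2) := by
  simp [fcls, cechFrac]

lemma fcls_two : fcls k (fE8p1 k) 2 = cechFrac 2 (X 2 * X 0) := by
  simp [fcls, cechFrac]

lemma exists_of_mem_Asub {c : Lloc k (fE8p1 k)} (hc : c ∈ Asub k (fE8p1 k)) :
    ∃ (m : ℕ) (s t : PS k),
      c * toL k ((X 0 * X 1) ^ m) = toL k (X 0 ^ m * s + X 1 ^ m * t) := by
  refine Submodule.span_induction ?_ ?_ ?_ ?_ hc
  · rintro _ (⟨w, rfl⟩ | ⟨w, rfl⟩)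
    · obtain ⟨m, r, hr⟩ := IsLocalization.Away.surj (xR k (fE8p1 k)) w
      obtain ⟨s, rfl⟩ := Ideal.Quotient.mk_surjective r
      refine ⟨m, 0, s, ?_⟩
      have := congrArg (phiX k (fE8p1 k)) hr
      rw [map_mul, map_pow, phiX, IsLocalization.Away.awayToAwayRight_eq,
        IsLocalization.Away.awayToAwayRight_eq] at this
      rw [mul_pow, map_mul, ← mul_assoc, mul_zero, zero_add, mul_comm (X 1 ^ m), map_mul]
      congr 1
      rw [map_pow]
      exact this
    · obtain ⟨m, r, hr⟩ := IsLocalization.Away.surj (yR k (fE8p1 k)) w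
      obtain ⟨s, rfl⟩ := Ideal.Quotient.mk_surjective r
      refine ⟨m, s, 0, ?_⟩
      have := congrArg (phiY k (fE8p1 k)) hr
      rw [map_mul, map_pow, phiY, IsLocalization.Away.awayToAwayLeft_eq,
        IsLocalization.Away.awayToAwayLeft_eq] at this
      rw [mul_comm (X 0) (X 1), mul_pow, map_mul, ← mul_assoc, mul_zero, add_zero,
        mul_comm (X 0 ^ m), map_mul]
      congr 1
      rw [map_pow]
      exact this
  · exact ⟨0, 0, 0, by simp⟩
  · rintro c d - - ⟨m, s, t, h⟩ ⟨m', s', t', h'⟩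
    refine ⟨m + m', X 1 ^ m' * s + X 1 ^ m * s', X 0 ^ m' * t + X 0 ^ m * t', ?_⟩
    simp only [map_mul, map_add, map_pow] at h h' ⊢
    linear_combination (toL k (X 0) * toL k (X 1)) ^ m' * h +
      (toL k (X 0) * toL k (X 1)) ^ m * h'
  · rintro r c - ⟨m, s, t, h⟩
    obtain ⟨a, rfl⟩ := Ideal.Quotient.mk_surjective r
    refine ⟨m, a * s, a * t, ?_⟩
    rw [mk_smul, mul_assoc, h, ← map_mul]
    congr 1
    ring

/-- `g / (xy)ⁿ` represents zero in `H²_m(R)` exactly when `g ∈ (xⁿ, yⁿ, f)`. -/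
lemma cechFrac_mem_Asub_iff {n : ℕ} {g : PS k} :
    cechFrac n g ∈ Asub k (fE8p1 k) ↔ g ∈ frobIdeal k n := by
  constructor
  · intro h
    obtain ⟨m, s, t, hst⟩ := exists_of_mem_Asub h
    have h1 : toL k ((X 0 * X 1) ^ m * g) =
        toL k ((X 0 * X 1) ^ n * (X 0 ^ m * s + X 1 ^ m * t)) := by
      rw [map_mul, map_mul, ← hst, ← cechFrac_mul n g]
      ring
    obtain ⟨N, hN⟩ := IsLocalization.Away.exists_of_eq
      (S := Lloc k (fE8p1 k)) (xR k (fE8p1 k) * yR k (fE8p1 k)) h1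
    have hN' : Ideal.Quotient.mk (Ideal.span {fE8p1 k}) ((X 0 * X 1) ^ N *
        ((X 0 * X 1) ^ m * g)) = Ideal.Quotient.mk _ ((X 0 * X 1) ^ N *
        ((X 0 * X 1) ^ n * (X 0 ^ m * s + X 1 ^ m * t))) := by
      rw [map_mul, map_mul (Ideal.Quotient.mk _) ((X 0 * X 1) ^ N), map_pow, map_mul]
      exact hN
    rw [Ideal.Quotient.mk_eq_mk_iff_sub_mem, Ideal.mem_span_singleton'] at hN'
    obtain ⟨q, hq⟩ := hN'
    refine mem_frobIdeal_of_mul_mem (m := N + m) (mem_frobIdeal.2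
      ⟨q, X 1 ^ (N + n) * s, X 0 ^ (N + n) * t, ?_⟩)
    linear_combination -hq
  · intro h
    obtain ⟨q, s, t, rfl⟩ := mem_frobIdeal.1 h
    let α := phiX k (fE8p1 k) (IsLocalization.Away.invSelf (xR k (fE8p1 k)))
    let β := phiY k (fE8p1 k) (IsLocalization.Away.invSelf (yR k (fE8p1 k)))
    have hα : toL k (X 0) * α = 1 := by
      have := congrArg (phiX k (fE8p1 k)) (IsLocalization.Away.mul_invSelf
        (S := Localization.Away (xR k (fE8p1 k))) (xR k (fE8p1 k)))
      rw [map_mul, map_one] at this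
      conv at this => lhs; arg 1; rw [phiX, IsLocalization.Away.awayToAwayRight_eq]
      exact this
    have hβ : toL k (X 1) * β = 1 := by
      have := congrArg (phiY k (fE8p1 k)) (IsLocalization.Away.mul_invSelf
        (S := Localization.Away (yR k (fE8p1 k))) (yR k (fE8p1 k)))
      rw [map_mul, map_one] at this
      conv at this => lhs; arg 1; rw [phiY, IsLocalization.Away.awayToAwayLeft_eq]
      exact this
    have key : cechFrac n (q * fE8p1 k + X 0 ^ n * s + X 1 ^ n * t) =
        Ideal.Quotient.mk (Ideal.span {fE8p1 k}) s • β ^ n +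
          Ideal.Quotient.mk (Ideal.span {fE8p1 k}) t • α ^ n := by
      symm
      refine eq_cechFrac ?_
      have hα' : toL k (X 0) ^ n * α ^ n = 1 := by rw [← mul_pow, hα, one_pow]
      have hβ' : toL k (X 1) ^ n * β ^ n = 1 := by rw [← mul_pow, hβ, one_pow]
      rw [mk_smul, mk_smul, map_add, map_add, map_mul, toL_fE8p1]
      simp only [map_mul, map_pow]
      linear_combination toL k t * toL k (X 1) ^ n * hα' + toL k s * toL k (X 0) ^ n * hβ'
    rw [key]
    refine add_mem (Submodule.smul_mem _ _ (Submodule.subset_span (Or.inr ?_)))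
      (Submodule.smul_mem _ _ (Submodule.subset_span (Or.inl ?_)))
    · exact ⟨_, map_pow _ _ _⟩
    · exact ⟨_, map_pow _ _ _⟩

/-- The coefficients of the numerator of `a₁ f₁ + a₂ f₂` over the denominator `(xy)ⁿ⁺²`. -/
def nilCoeff (n : ℕ) (a₁ a₂ : k) : ℕ → ℕ → k :=
  fun i j => if i = n + 1 ∧ j = n + 1 then a₁ else if i = n + 1 ∧ j = n then a₂ else 0

lemma smul_fcls_add_eq (n : ℕ) (a₁ a₂ : k) :
    algebraMap k (Rq k (fE8p1 k)) a₁ • fcls k (fE8p1 k) 1 +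
      algebraMap k (Rq k (fE8p1 k)) a₂ • fcls k (fE8p1 k) 2 =
    cechFrac (n + 2) (X 2 * planar (nilCoeff n a₁ a₂)) := by
  have hp (a : k) : C a = planar fun i j => if i = 0 ∧ j = 0 then a else 0 := by
    ext e
    have he : e = 0 ↔ e 0 = 0 ∧ e 1 = 0 ∧ e 2 = 0 := by
      rw [DFunLike.ext_iff, Fin.forall_fin_succ, Fin.forall_fin_succ, Fin.forall_fin_one]; rfl
    rw [coeff_C, coeff_planar]
    simp only [he]
    split_ifs <;> simp_all
  have hn : nilCoeff n a₁ a₂ =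
      shiftCoeff (n + 1) (n + 1) (fun i j => if i = 0 ∧ j = 0 then a₁ else 0) +
      shiftCoeff (n + 1) n (fun i j => if i = 0 ∧ j = 0 then a₂ else 0) := by
    ext i j
    simp only [nilCoeff, shiftCoeff, Pi.add_apply]
    split_ifs <;> first | omega | simp
  rw [fcls_one, fcls_two, algebraMap_smul_cechFrac, algebraMap_smul_cechFrac,
    cechFrac_add_pow 1 (n + 1), cechFrac_add_pow 2 n, add_comm 2 n, add_comm 1 (n + 1),
    ← cechFrac_add, hn, planar_add, ← monomial_mul_planar, ← monomial_mul_planar, ← hp, ← hp]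
  congr 1
  ring

/-- If the Frobenius image of a class is a combination of `f₁` and `f₂`, so is the class. -/
lemma exists_smul_fcls_of_sq [CharP k 2] {c : Lloc k (fE8p1 k)} {b₁ b₂ : k}
    (h : c ^ 2 - (algebraMap k (Rq k (fE8p1 k)) b₁ • fcls k (fE8p1 k) 1 +
      algebraMap k (Rq k (fE8p1 k)) b₂ • fcls k (fE8p1 k) 2) ∈ Asub k (fE8p1 k)) :
    ∃ a₁ a₂ : k, c - (algebraMap k (Rq k (fE8p1 k)) a₁ • fcls k (fE8p1 k) 1 +
      algebraMap k (Rq k (fE8p1 k)) a₂ • fcls k (fE8p1 k) 2) ∈ Asub k (fE8p1 k) := by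
  obtain ⟨n, g, rfl⟩ : ∃ n g, c = cechFrac (n + 2) g := by
    obtain ⟨n, g, rfl⟩ := exists_cechFrac c
    exact ⟨n, _, cechFrac_add_pow n 2 g⟩
  obtain ⟨u, v, huv⟩ := exists_normalForm (n + 2) g
  have hsq : cechFrac (n + 2) g ^ 2 -
      cechFrac (n + 2) (planar u + X 2 * planar v) ^ 2 ∈ Asub k (fE8p1 k) := by
    obtain ⟨q, s, t, hq⟩ := mem_frobIdeal.1 huv
    rw [cechFrac_sq, cechFrac_sq, ← cechFrac_sub, cechFrac_mem_Asub_iff, mem_frobIdeal]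
    refine ⟨q ^ 2 * fE8p1 k, s ^ 2, t ^ 2, ?_⟩
    have e1 : g = planar u + X 2 * planar v + (q * fE8p1 k + X 0 ^ (n + 2) * s +
      X 1 ^ (n + 2) * t) := by rw [← hq]; ring
    rw [e1]
    linear_combination ((planar u + X 2 * planar v) * (q * fE8p1 k + X 0 ^ (n + 2) * s +
      X 1 ^ (n + 2) * t) + q * fE8p1 k * X 0 ^ (n + 2) * s + q * fE8p1 k * X 1 ^ (n + 2) * t +
      X 0 ^ (n + 2) * s * X 1 ^ (n + 2) * t) * two_eq_zero_PS (k := k)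
  have hA := sub_mem h hsq
  rw [smul_fcls_add_eq (2 * n + 2), show 2 * n + 2 + 2 = 2 * (n + 2) by ring,
    sub_sub_sub_cancel_left, cechFrac_sq, ← cechFrac_sub, cechFrac_mem_Asub_iff,
    normalForm_sq] at hA
  have hB := sub_mem hA (mem_frobIdeal.2 ⟨planar (sqCoeff v), 0, 0, by ring⟩ :
    planar (sqCoeff v) * fE8p1 k ∈ frobIdeal k (2 * (n + 2)))
  have hC : planar (sqCoeff u - shiftCoeff 3 0 (sqCoeff v) - shiftCoeff 0 5 (sqCoeff v)) +
      X 2 * planar (-shiftCoeff 1 3 (sqCoeff v) - nilCoeff (2 * n + 2) b₁ b₂) ∈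
      frobIdeal k (2 * (n + 2)) := by
    rw [planar_sub (-shiftCoeff 1 3 (sqCoeff v))]
    convert hB using 1
    ring
  have hcoeff {i j : ℕ} := normalForm_coeff_eq_zero hC (i := i) (j := j)
  simp only [Pi.sub_apply, Pi.neg_apply] at hcoeff
  have hu (i j : ℕ) (hi : i < n + 2) (hj : j < n + 2) : u i j = 0 := by
    have := (hcoeff (i := 2 * i) (j := 2 * j) (by omega) (by omega)).1
    rw [sqCoeff_two_mul, shiftCoeff_eq_zero fun h _ => sqCoeff_of_odd _ (by omega),
      shiftCoeff_eq_zero fun _ h => sqCoeff_of_odd _ (by omega)] at this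
    simpa using this
  have hv (i j : ℕ) (hi : i < n + 1) (hj : j < n + 2) : v i j = 0 := by
    have := (hcoeff (i := 2 * i + 3) (j := 2 * j + 0) (by omega) (by omega)).1
    rw [sqCoeff_of_odd _ (by omega), shiftCoeff_add, sqCoeff_two_mul,
      shiftCoeff_eq_zero fun _ h => sqCoeff_of_odd _ (by omega)] at this
    simpa using this
  have hv' (j : ℕ) (hj : j < n) : v (n + 1) j = 0 := by
    have := (hcoeff (i := 2 * (n + 1) + 1) (j := 2 * j + 3) (by omega) (by omega)).2
    rw [shiftCoeff_add, sqCoeff_two_mul, nilCoeff, if_neg (by omega), if_neg (by omega)] at this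
    simpa using this
  refine ⟨v (n + 1) (n + 1), v (n + 1) n, ?_⟩
  rw [smul_fcls_add_eq n, ← cechFrac_sub, cechFrac_mem_Asub_iff]
  have h0 : planar u + X 2 * planar (v - nilCoeff n (v (n + 1) (n + 1)) (v (n + 1) n)) ∈
      frobIdeal k (n + 2) := by
    refine normalForm_mem fun i j hi hj => ⟨hu i j hi hj, ?_⟩
    rw [Pi.sub_apply, Pi.sub_apply, nilCoeff]
    split_ifs with h1 h2
    · rw [h1.1, h1.2, sub_self]
    · rw [h2.1, h2.2, sub_self]
    · rw [sub_zero]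
      rcases Nat.lt_or_ge i (n + 1) with h | h
      · exact hv i j h hj
      · obtain rfl : i = n + 1 := by omega
        exact hv' j (by omega)
  rw [planar_sub] at h0
  convert add_mem huv h0 using 1
  ring

lemma exists_smul_fcls_of_pow [CharP k 2] (m : ℕ) (c : Lloc k (fE8p1 k))
    (h : c ^ 2 ^ m ∈ Asub k (fE8p1 k)) :
    ∃ a₁ a₂ : k, c - (algebraMap k (Rq k (fE8p1 k)) a₁ • fcls k (fE8p1 k) 1 +
      algebraMap k (Rq k (fE8p1 k)) a₂ • fcls k (fE8p1 k) 2) ∈ Asub k (fE8p1 k) := by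
  induction m generalizing c with
  | zero =>
    have h0 (d : Lloc k (fE8p1 k)) : algebraMap k (Rq k (fE8p1 k)) 0 • d = 0 := by
      rw [map_zero]
      exact zero_smul (Rq k (fE8p1 k)) d
    refine ⟨0, 0, ?_⟩
    rw [h0, h0, add_zero, sub_zero]
    simpa using h
  | succ m ih =>
    rw [pow_succ', pow_mul] at h
    obtain ⟨b₁, b₂, hb⟩ := ih _ h
    exact exists_smul_fcls_of_sq hb

end CechCohomology

/-- For the rational double point `R` of type `E_8^1` in characteristic `2`,
the Frobenius-nilpotent part `H^2_m(R)[F^∞]` of the local cohomology `L/A` is two-dimensional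
over `k`, spanned by the classes of `f₁ = z/(xy)` and `f₂ = z/(xy²)`, with `F(f₂) = f₁` and
`F(f₁) = 0`. -/
theorem localCohomology_E8p1_char2 (k : Type) [Field k] [IsAlgClosed k] [CharP k 2] :
    -- (i) f₁² ∈ A
    (fcls k (fE8p1 k) 1) ^ 2 ∈ Asub k (fE8p1 k) ∧
    -- (ii) f₂² - f₁ ∈ A, i.e. Frobenius sends the class of f₂ to the class of f₁
    (fcls k (fE8p1 k) 2) ^ 2 - fcls k (fE8p1 k) 1 ∈ Asub k (fE8p1 k) ∧
    -- (iii) the images of f₁ and f₂ in L/A are k-linearly independent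
    (∀ a₁ a₂ : k,
      algebraMap k (Rq k (fE8p1 k)) a₁ • fcls k (fE8p1 k) 1 +
        algebraMap k (Rq k (fE8p1 k)) a₂ • fcls k (fE8p1 k) 2 ∈ Asub k (fE8p1 k) →
      a₁ = 0 ∧ a₂ = 0) ∧
    -- (iv) every Frobenius-nilpotent class is a k-linear combination of f₁ and f₂
    (∀ c : Lloc k (fE8p1 k), (∃ m : ℕ, c ^ 2 ^ m ∈ Asub k (fE8p1 k)) →
      ∃ a₁ a₂ : k,
        c - algebraMap k (Rq k (fE8p1 k)) a₁ • fcls k (fE8p1 k) 1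
          - algebraMap k (Rq k (fE8p1 k)) a₂ • fcls k (fE8p1 k) 2 ∈ Asub k (fE8p1 k)) := by
  refine ⟨?_, ?_, fun a₁ a₂ h => ?_, fun c ⟨m, hm⟩ => ?_⟩
  · rw [fcls_one, cechFrac_sq, cechFrac_mem_Asub_iff, mem_frobIdeal]
    exact ⟨1, -X 0, -(X 1 ^ 3 + X 0 * X 1 * X 2), by ring⟩
  · rw [fcls_one, fcls_two, cechFrac_sq, cechFrac_add_pow 1 3, ← cechFrac_sub,
      cechFrac_mem_Asub_iff, mem_frobIdeal]
    refine ⟨X 0 ^ 2, -X 0, -(X 0 ^ 2 * X 1), ?_⟩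
    linear_combination -(X 0 ^ 3 * X 1 ^ 3 * X 2) * two_eq_zero_PS (k := k)
  · rw [smul_fcls_add_eq 0, cechFrac_mem_Asub_iff, ← zero_add (X 2 * _), ← planar_zero] at h
    have h11 := (normalForm_coeff_eq_zero h (i := 1) (j := 1) (by simp) (by simp)).2
    have h10 := (normalForm_coeff_eq_zero h (i := 1) (j := 0) (by simp) (by simp)).2
    simp only [nilCoeff] at h11 h10
    exact ⟨by simpa using h11, by simpa using h10⟩
  · obtain ⟨a₁, a₂, h⟩ := exists_smul_fcls_of_pow m c hm
    exact ⟨a₁, a₂, by rwa [sub_sub]⟩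
end
end

section
/- Let k be an algebraically closed field of characteristic 3 and let S := k⟦u,v⟧ be the formal power series ring in two variables. Let D be any k-linear derivation of S with D(u) = v and D(v) = −u^3 (i.e. D = v·∂/∂u − u^3·∂/∂v; such D is unique, and satisfies D^3 = 0). Then: (i) the elements u^4 − v^2, u^3, and v^3 lie in the kernel subalgebra ker D = {f ∈ S : D(f) = 0}; (ii) ker D is isomorphic as a k-algebra to k⟦x,y,z⟧/(z^2 + x^3 − y^4), i.e. to the rational double point of type E_6^0 in characteristic 3, via an isomorphism sending x ↦ u^4 − v^2, y ↦ u^3, z ↦ v^3. -/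
set_option maxHeartbeats 1000000
set_option synthInstance.maxHeartbeats 400000

open MvPowerSeries

noncomputable section

variable (k : Type) [Field k]

/-- The formal power series ring `k⟦u,v⟧`. -/
abbrev P2 := MvPowerSeries (Fin 2) k

/-- The kernel subalgebra `ker D = {f ∈ k⟦u,v⟧ : D(f) = 0}` of a derivation `D`. -/
def kerSubalgebra (D : Derivation k (P2 k) (P2 k)) : Subalgebra k (P2 k) where
  carrier := {g | D g = 0}
  mul_mem' := fun ha hb => by
    simp only [Set.mem_setOf_eq] at *
    rw [D.leibniz, ha, hb, smul_zero, smul_zero, add_zero]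
  one_mem' := D.map_one_eq_zero
  add_mem' := fun ha hb => by
    simp only [Set.mem_setOf_eq] at *
    rw [map_add, ha, hb, add_zero]
  zero_mem' := map_zero D
  algebraMap_mem' := fun r => D.map_algebraMap r

/-- The rational double point of type `E_6^0` in characteristic 3:
`k⟦x,y,z⟧/(z² + x³ − y⁴)`. -/
abbrev E6p0 : Type :=
  MvPowerSeries (Fin 3) k ⧸
    Ideal.span {(X 2 : MvPowerSeries (Fin 3) k) ^ 2 + X 0 ^ 3 - X 1 ^ 4}

namespace MvPowerSeries

/-- The exponent vector of the monomial `u ^ i * v ^ j`. -/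
def bidegree (i j : ℕ) : Fin 2 →₀ ℕ := Finsupp.single 0 i + Finsupp.single 1 j

@[simp]
lemma bidegree_zero (i j : ℕ) : bidegree i j 0 = i := by
  simp [bidegree]

@[simp]
lemma bidegree_one (i j : ℕ) : bidegree i j 1 = j := by
  simp [bidegree]

lemma X_pow_mul_X_pow {R : Type*} [CommSemiring R] (i j : ℕ) :
    (X 0 : MvPowerSeries (Fin 2) R) ^ i * X 1 ^ j = monomial (bidegree i j) 1 := by
  simp [X_pow_eq, monomial_mul_monomial, bidegree]

lemma exists_eq_three_smul_add_bidegree (n : Fin 2 →₀ ℕ) :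
    ∃ (m : Fin 2 →₀ ℕ) (i j : Fin 3), n = 3 • m + bidegree i j := by
  refine ⟨bidegree (n 0 / 3) (n 1 / 3), ⟨n 0 % 3, Nat.mod_lt _ (by norm_num)⟩,
    ⟨n 1 % 3, Nat.mod_lt _ (by norm_num)⟩, ?_⟩
  ext s
  fin_cases s <;> simp <;> omega

variable {R : Type*} [CommRing R]

/-- The power series `∑ cᵢⱼ(u³, v³) uⁱ vʲ`, the sum running over `0 ≤ i, j ≤ 2`. -/
def ofDigits (c : Fin 3 → Fin 3 → MvPowerSeries (Fin 2) R) : MvPowerSeries (Fin 2) R :=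
  ∑ i, ∑ j, expand 3 three_ne_zero (c i j) * (X 0 ^ (i : ℕ) * X 1 ^ (j : ℕ))

lemma coeff_expand_mul_X_pow_mul_X_pow (c : MvPowerSeries (Fin 2) R) (m : Fin 2 →₀ ℕ)
    (i j a b : Fin 3) :
    coeff (3 • m + bidegree i j)
      (expand 3 three_ne_zero c * ((X 0 : MvPowerSeries (Fin 2) R) ^ (a : ℕ) * X 1 ^ (b : ℕ))) =
      if a = i ∧ b = j then coeff m c else 0 := by
  rw [X_pow_mul_X_pow]
  split_ifs with h
  · rw [h.1, h.2, coeff_add_mul_monomial, coeff_expand_smul, mul_one]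
  · rw [coeff_mul_monomial, mul_one]
    split_ifs with hle
    · have h0 := hle 0
      have h1 := hle 1
      simp only [bidegree_zero, bidegree_one, Finsupp.add_apply, Finsupp.smul_apply,
        smul_eq_mul] at h0 h1
      by_cases ha : a = i
      · refine coeff_expand_of_not_dvd 3 three_ne_zero c (i := 1) ?_
        have hb : (b : ℕ) ≠ j := fun hb ↦ h ⟨ha, Fin.ext hb⟩
        simp only [bidegree_one, Finsupp.add_apply, Finsupp.smul_apply, Finsupp.tsub_apply,
          smul_eq_mul]
        omega
      · refine coeff_expand_of_not_dvd 3 three_ne_zero c (i := 0) ?_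
        have ha' : (a : ℕ) ≠ i := fun hb ↦ ha (Fin.ext hb)
        simp only [bidegree_zero, Finsupp.add_apply, Finsupp.smul_apply, Finsupp.tsub_apply,
          smul_eq_mul]
        omega
    · rfl

lemma coeff_ofDigits (c : Fin 3 → Fin 3 → MvPowerSeries (Fin 2) R) (m : Fin 2 →₀ ℕ)
    (i j : Fin 3) : coeff (3 • m + bidegree i j) (ofDigits c) = coeff m (c i j) := by
  simp [ofDigits, coeff_expand_mul_X_pow_mul_X_pow, ite_and]

lemma ofDigits_injective :
    Function.Injective (ofDigits : (Fin 3 → Fin 3 → MvPowerSeries (Fin 2) R) → _) := by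
  intro c d h
  ext i j m
  rw [← coeff_ofDigits c, h, coeff_ofDigits]

lemma ofDigits_surjective :
    Function.Surjective (ofDigits : (Fin 3 → Fin 3 → MvPowerSeries (Fin 2) R) → _) := by
  intro f
  let c (i j : Fin 3) : MvPowerSeries (Fin 2) R := fun m ↦ coeff (3 • m + bidegree i j) f
  refine ⟨c, ?_⟩
  ext n
  obtain ⟨m, i, j, rfl⟩ := exists_eq_three_smul_add_bidegree n
  exact coeff_ofDigits c m i j

@[simp]
lemma ofDigits_zero : ofDigits (0 : Fin 3 → Fin 3 → MvPowerSeries (Fin 2) R) = 0 := by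
  simp [ofDigits]

lemma finSuccEquiv_rename_succ {n : ℕ} (g : MvPowerSeries (Fin n) R) :
    finSuccEquiv R n (rename Fin.succ g) = PowerSeries.C g := by
  ext i x
  rw [coeff_coeff_finSuccEquiv, PowerSeries.coeff_C]
  split_ifs with hi
  · subst hi
    have hx : x.cons 0 = x.embDomain (Fin.succEmb n) := by
      ext a
      refine Fin.cases ?_ (fun a ↦ ?_) a
      · rw [Finsupp.cons_zero, Finsupp.embDomain_of_notMem_range]
        rintro ⟨b, hb⟩
        exact Fin.succ_ne_zero b hb
      · rw [Finsupp.cons_succ]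
        exact (Finsupp.embDomain_apply_self (Fin.succEmb n) x a).symm
    rw [hx]
    exact coeff_embDomain_rename (Fin.succEmb n) g x
  · rw [coeff_zero]
    refine coeff_rename_eq_zero (f := Fin.succ) g ?_
    rintro ⟨y, hy⟩
    have h0 := DFunLike.congr_fun hy 0
    rw [Finsupp.cons_zero, Finsupp.mapDomain_of_notMem_range] at h0
    · exact hi h0.symm
    · rintro ⟨b, hb⟩
      exact Fin.succ_ne_zero b hb

/-- Weierstrass division by `x₀ ^ d - t(x₁, …, xₙ)`, where `t` has no constant term. -/
lemma exists_eq_mul_add_sum_rename [Nontrivial R] {n : ℕ} (d : ℕ)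
    (t : MvPowerSeries (Fin n) R) (ht : t ∈ Ideal.span (Set.range X))
    (f : MvPowerSeries (Fin (n + 1)) R) :
    ∃ (q : MvPowerSeries (Fin (n + 1)) R) (r : Fin d → MvPowerSeries (Fin n) R),
      f = (X 0 ^ d - rename Fin.succ t) * q + ∑ i, rename Fin.succ (r i) * X 0 ^ (i : ℕ) := by
  let I : Ideal (MvPowerSeries (Fin n) R) := Ideal.span (Set.range X)
  let g : PowerSeries (MvPowerSeries (Fin n) R) := PowerSeries.X ^ d - PowerSeries.C t
  have hI : I ≤ RingHom.ker constantCoeff := by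
    rw [Ideal.span_le]
    rintro _ ⟨i, rfl⟩
    exact constantCoeff_X i
  have hI' : I ≠ ⊤ := ne_top_of_le_ne_top (RingHom.ker_ne_top _) hI
  have : Nontrivial (MvPowerSeries (Fin n) R ⧸ I) := Ideal.Quotient.nontrivial_iff.mpr hI'
  have hmap : (g.map (Ideal.Quotient.mk I)).order.toNat = d := by
    have ht' : Ideal.Quotient.mk I t = 0 := Ideal.Quotient.eq_zero_iff_mem.mpr ht
    simp [g, ht']
  have hg : g.IsWeierstrassDivisorAt I := by
    rw [PowerSeries.IsWeierstrassDivisorAt, hmap]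
    rcases eq_or_ne d 0 with rfl | hd
    · have ht0 : constantCoeff t = 0 := hI ht
      simp [g, MvPowerSeries.isUnit_iff_constantCoeff, ht0]
    · simp [g, PowerSeries.coeff_X_pow, PowerSeries.coeff_C, hd]
  obtain ⟨hdeg, heq⟩ := hg.isWeierstrassDivisionAt_div_mod (finSuccEquiv R n f)
  rw [hmap] at hdeg
  refine ⟨(finSuccEquiv R n).symm (hg.div (finSuccEquiv R n f)),
    fun i ↦ (hg.mod (finSuccEquiv R n f)).coeff i, (finSuccEquiv R n).injective ?_⟩
  have hr : ((hg.mod (finSuccEquiv R n f) : Polynomial (MvPowerSeries (Fin n) R)) :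
      PowerSeries (MvPowerSeries (Fin n) R)) =
      ∑ i : Fin d, PowerSeries.C ((hg.mod (finSuccEquiv R n f)).coeff i) *
        PowerSeries.X ^ (i : ℕ) := by
    ext1 m
    simp only [Polynomial.coeff_coe, map_sum, PowerSeries.coeff_C_mul, PowerSeries.coeff_X_pow]
    rcases lt_or_ge m d with hm | hm
    · rw [Finset.sum_eq_single ⟨m, hm⟩] <;> simp +contextual [Fin.ext_iff, eq_comm]
    · rw [Polynomial.coeff_eq_zero_of_degree_lt (hdeg.trans_le (by exact_mod_cast hm)),
        Finset.sum_eq_zero]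
      intro i _
      rw [if_neg (by omega), mul_zero]
  conv_lhs => rw [heq, hr]
  simp [g, finSuccEquiv_rename_succ]

lemma X_ne_zero [Nontrivial R] {σ : Type*} (s : σ) : (X s : MvPowerSeries σ R) ≠ 0 := fun h ↦ by
  simpa [coeff_index_single_self_X] using congrArg (coeff (Finsupp.single s 1)) h

lemma X_dvd_of_dvd_X_mul {σ : Type*} {s t : σ} (hst : s ≠ t) {f : MvPowerSeries σ R}
    (h : X s ∣ X t * f) : X s ∣ f := by
  classical
  rw [X_dvd_iff] at h ⊢
  intro m hm
  have := h (Finsupp.single t 1 + m) (by simp [hm, hst])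
  rwa [X, coeff_add_monomial_mul, one_mul] at this

end MvPowerSeries

section Derivation

variable {k : Type} [Field k]

lemma three_eq_zero [CharP k 3] : (3 : P2 k) = 0 := by
  have h : (3 : k) = 0 := CharP.cast_eq_zero k 3
  rw [← map_ofNat (algebraMap k (P2 k)) 3, h, map_zero]

lemma exists_pow_three_eq_expand [CharP k 3] [PerfectRing k 3] (g : P2 k) :
    ∃ h : P2 k, h ^ 3 = expand 3 three_ne_zero g := by
  refine ⟨map (frobeniusEquiv k 3).symm.toRingHom g, ?_⟩
  rw [← map_frobenius_expand 3 three_ne_zero, ← map_expand]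
  ext m
  simp

lemma Derivation.map_expand_three [CharP k 3] [PerfectRing k 3]
    (D : Derivation k (P2 k) (P2 k)) (g : P2 k) : D (expand 3 three_ne_zero g) = 0 := by
  obtain ⟨h, hh⟩ := exists_pow_three_eq_expand g
  rw [← hh, D.leibniz_pow, ← Nat.cast_smul_eq_nsmul (P2 k)]
  simp [three_eq_zero]

/-- The effect of `v ∂/∂u - u³ ∂/∂v` on the coefficients `cᵢⱼ` of `ofDigits c`. -/
def derivDigits (c : Fin 3 → Fin 3 → P2 k) : Fin 3 → Fin 3 → P2 k :=
  ![![X 1 * c 1 2 - X 0 * c 0 1, c 1 0 + X 0 * c 0 2, c 1 1],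
    ![-(X 1 * c 2 2) - X 0 * c 1 1, -c 2 0 + X 0 * c 1 2, -c 2 1],
    ![-(X 0 * c 2 1), X 0 * c 2 2, 0]]

lemma Derivation.map_ofDigits [CharP k 3] [PerfectRing k 3]
    (D : Derivation k (P2 k) (P2 k)) (hDu : D (X 0) = X 1)
    (hDv : D (X 1) = -(X 0 ^ 3)) (c : Fin 3 → Fin 3 → P2 k) :
    D (ofDigits c) = ofDigits (derivDigits c) := by
  simp only [ofDigits, derivDigits, Fin.sum_univ_three, map_add, Derivation.leibniz,
    Derivation.map_expand_three, Derivation.leibniz_pow, hDu, hDv]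
  simp
  linear_combination
    (X 0 * X 1 * expand 3 three_ne_zero (c 2 0) + X 0 * X 1 ^ 2 * expand 3 three_ne_zero (c 2 1) +
      X 0 * X 1 ^ 3 * expand 3 three_ne_zero (c 2 2) -
      X 0 ^ 3 * X 1 * expand 3 three_ne_zero (c 0 2) -
      X 0 ^ 4 * X 1 * expand 3 three_ne_zero (c 1 2) -
      X 0 ^ 5 * X 1 * expand 3 three_ne_zero (c 2 2)) * three_eq_zero (k := k)

lemma derivDigits_iterate_three (c : Fin 3 → Fin 3 → P2 k) :
    derivDigits (derivDigits (derivDigits c)) = 0 := by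
  funext i j
  fin_cases i <;> fin_cases j <;> simp [derivDigits]
  all_goals ring

/-- The digits of `∑ rᵢ(u³, v³) (u⁴ - v²)ⁱ`. -/
def kerDigits (r : Fin 3 → P2 k) : Fin 3 → Fin 3 → P2 k :=
  ![![r 0, X 1 * r 2, -r 1], ![X 0 * r 1, 0, X 0 * r 2], ![X 0 ^ 2 * r 2, 0, 0]]

lemma sum_expand_mul_pow [CharP k 3] (r : Fin 3 → P2 k) :
    ∑ i, expand 3 three_ne_zero (r i) * (X 0 ^ 4 - X 1 ^ 2 : P2 k) ^ (i : ℕ) =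
      ofDigits (kerDigits r) := by
  simp [ofDigits, kerDigits, Fin.sum_univ_three]
  linear_combination
    -(X 0 ^ 4 * X 1 ^ 2 * expand 3 three_ne_zero (r 2)) * three_eq_zero (k := k)

lemma kerDigits_eq_zero {r : Fin 3 → P2 k} (h : kerDigits r = 0) : r = 0 := by
  have hX : (X 0 : P2 k) ^ 2 ≠ 0 := pow_ne_zero 2 (X_ne_zero 0)
  funext i
  fin_cases i
  · exact congrFun (congrFun h 0) 0
  · exact neg_eq_zero.mp (congrFun (congrFun h 0) 2)
  · exact (mul_eq_zero_iff_left hX).mp (congrFun (congrFun h 2) 0)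

lemma derivDigits_kerDigits (r : Fin 3 → P2 k) :
    derivDigits (kerDigits r) = 0 := by
  funext i j
  fin_cases i <;> fin_cases j <;> simp [derivDigits, kerDigits]
  all_goals ring

lemma exists_kerDigits_eq {c : Fin 3 → Fin 3 → P2 k} (h : derivDigits c = 0) :
    ∃ r, kerDigits r = c := by
  have hX : (X 0 : P2 k) ≠ 0 := X_ne_zero 0
  have h00 : X 1 * c 1 2 - X 0 * c 0 1 = 0 := congrFun (congrFun h 0) 0
  have h01 : c 1 0 + X 0 * c 0 2 = 0 := congrFun (congrFun h 0) 1
  have h02 : c 1 1 = 0 := congrFun (congrFun h 0) 2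
  have h11 : -c 2 0 + X 0 * c 1 2 = 0 := congrFun (congrFun h 1) 1
  have h12 : -c 2 1 = 0 := congrFun (congrFun h 1) 2
  have h21 : X 0 * c 2 2 = 0 := congrFun (congrFun h 2) 1
  obtain ⟨e, he⟩ : X 0 ∣ c 1 2 :=
    X_dvd_of_dvd_X_mul (t := 1) (by simp) ⟨c 0 1, sub_eq_zero.mp h00⟩
  have h01' : X 1 * e = c 0 1 := by
    refine mul_left_cancel₀ hX ?_
    linear_combination h00 - X 1 * he
  refine ⟨![c 0 0, -c 0 2, e], ?_⟩
  funext i j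
  fin_cases i <;> fin_cases j <;> simp [kerDigits]
  · exact h01'
  · linear_combination -h01
  · exact h02.symm
  · exact he.symm
  · linear_combination h11 - X 0 * he
  · linear_combination h12
  · exact (mul_left_cancel₀ hX (h21.trans (mul_zero _).symm)).symm

lemma hasSubst_generators :
    HasSubst (![X 0 ^ 4 - X 1 ^ 2, X 0 ^ 3, X 1 ^ 3] : Fin 3 → P2 k) :=
  hasSubst_of_constantCoeff_zero fun i ↦ by fin_cases i <;> simp

/-- Substitution of `u⁴ - v²`, `u³`, `v³` for `x`, `y`, `z`. -/
def toP2 : MvPowerSeries (Fin 3) k →ₐ[k] P2 k :=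
  substAlgHom hasSubst_generators

lemma toP2_X (i : Fin 3) :
    toP2 (X i : MvPowerSeries (Fin 3) k) = ![X 0 ^ 4 - X 1 ^ 2, X 0 ^ 3, X 1 ^ 3] i :=
  substAlgHom_X _ i

lemma toP2_rename_succ (g : P2 k) : toP2 (rename Fin.succ g) = expand 3 three_ne_zero g := by
  rw [toP2, rename_eq_subst, substAlgHom_apply,
    subst_comp_subst_apply (HasSubst.X_comp _) hasSubst_generators, expand, substAlgHom_apply]
  congr 1
  funext i
  rw [Function.comp_apply, subst_X hasSubst_generators]
  fin_cases i <;> rfl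

lemma toP2_relation [CharP k 3] :
    toP2 ((X 2 : MvPowerSeries (Fin 3) k) ^ 2 + X 0 ^ 3 - X 1 ^ 4) = 0 := by
  simp only [map_sub, map_add, map_pow, toP2_X]
  simp
  linear_combination (X 1 ^ 4 * X 0 ^ 4 - X 1 ^ 2 * X 0 ^ 8 : P2 k) * three_eq_zero (k := k)

lemma exists_eq_mul_relation_add (f : MvPowerSeries (Fin 3) k) :
    ∃ (q : MvPowerSeries (Fin 3) k) (r : Fin 3 → P2 k),
      f = (X 2 ^ 2 + X 0 ^ 3 - X 1 ^ 4) * q + ∑ i, rename Fin.succ (r i) * X 0 ^ (i : ℕ) := by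
  have ht : (X 0 ^ 4 - X 1 ^ 2 : P2 k) ∈ Ideal.span (Set.range X) :=
    sub_mem (Ideal.pow_mem_of_mem _ (Ideal.subset_span (Set.mem_range_self 0)) 4 (by norm_num))
      (Ideal.pow_mem_of_mem _ (Ideal.subset_span (Set.mem_range_self 1)) 2 (by norm_num))
  obtain ⟨q, r, h⟩ := exists_eq_mul_add_sum_rename 3 (X 0 ^ 4 - X 1 ^ 2 : P2 k) ht f
  refine ⟨q, r, h.trans ?_⟩
  simp only [map_sub, map_pow, rename_X, Fin.succ_zero_eq_one, Fin.succ_one_eq_two]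
  ring

lemma toP2_mul_relation_add [CharP k 3] (q : MvPowerSeries (Fin 3) k) (r : Fin 3 → P2 k) :
    toP2 ((X 2 ^ 2 + X 0 ^ 3 - X 1 ^ 4) * q + ∑ i, rename Fin.succ (r i) * X 0 ^ (i : ℕ)) =
      ofDigits (kerDigits r) := by
  rw [map_add, map_mul, toP2_relation, zero_mul, zero_add, ← sum_expand_mul_pow]
  simp only [map_sum, map_mul, map_pow, toP2_rename_succ, toP2_X 0, Matrix.cons_val_zero]

lemma ker_toP2 [CharP k 3] : RingHom.ker (toP2 (k := k)) =
    Ideal.span {(X 2 : MvPowerSeries (Fin 3) k) ^ 2 + X 0 ^ 3 - X 1 ^ 4} := by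
  refine le_antisymm (fun f hf ↦ ?_) ((Ideal.span_singleton_le_iff_mem _).mpr toP2_relation)
  obtain ⟨q, r, rfl⟩ := exists_eq_mul_relation_add f
  rw [RingHom.mem_ker, toP2_mul_relation_add] at hf
  have hr : r = 0 := kerDigits_eq_zero (ofDigits_injective (hf.trans ofDigits_zero.symm))
  simp [hr, Ideal.mem_span_singleton]

lemma range_toP2 [CharP k 3] [PerfectRing k 3] (D : Derivation k (P2 k) (P2 k))
    (hDu : D (X 0) = X 1) (hDv : D (X 1) = -(X 0 ^ 3)) :
    (toP2 (k := k)).range = kerSubalgebra k D := by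
  ext g
  refine ⟨?_, fun hg ↦ ?_⟩
  · rintro ⟨f, rfl⟩
    obtain ⟨q, r, rfl⟩ := exists_eq_mul_relation_add f
    change D (toP2 _) = 0
    rw [toP2_mul_relation_add, D.map_ofDigits hDu hDv, derivDigits_kerDigits, ofDigits_zero]
  · obtain ⟨c, rfl⟩ := ofDigits_surjective g
    change D _ = 0 at hg
    rw [D.map_ofDigits hDu hDv] at hg
    obtain ⟨r, rfl⟩ := exists_kerDigits_eq (ofDigits_injective (hg.trans ofDigits_zero.symm))
    exact ⟨_, toP2_mul_relation_add 0 r⟩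

end Derivation

/-- Over an algebraically closed field `k` of characteristic 3, let `D`
be any derivation of `S = k⟦u,v⟧` with `D(u) = v`, `D(v) = −u³` (such `D` is unique and
satisfies `D³ = 0`).  Then `u⁴ − v²`, `u³` and `v³` lie in `ker D`, and `ker D` is
isomorphic as a `k`-algebra to `k⟦x,y,z⟧/(z² + x³ − y⁴)`, the rational double point of
type `E_6^0` in characteristic 3, via an isomorphism sending `x ↦ u⁴ − v²`, `y ↦ u³`,
`z ↦ v³`. -/
theorem alpha3_quotient_E6p0_char3 (k : Type) [Field k] [IsAlgClosed k] [CharP k 3]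
    (D : Derivation k (P2 k) (P2 k)) (hDu : D (X 0) = X 1) (hDv : D (X 1) = -(X 0 ^ 3)) :
    -- such D is unique
    (∀ D' : Derivation k (P2 k) (P2 k), D' (X 0) = X 1 → D' (X 1) = -(X 0 ^ 3) →
      D' = D) ∧
    -- D satisfies D³ = 0
    (∀ g : P2 k, D (D (D g)) = 0) ∧
    -- (i) u⁴ − v², u³ and v³ lie in ker D
    (X 0 ^ 4 - X 1 ^ 2 ∈ kerSubalgebra k D) ∧
    (X 0 ^ 3 ∈ kerSubalgebra k D) ∧
    ((X 1 : P2 k) ^ 3 ∈ kerSubalgebra k D) ∧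
    -- (ii) ker D is the E_6^0 singularity via x ↦ u⁴ − v², y ↦ u³, z ↦ v³
    ∃ e : E6p0 k ≃ₐ[k] kerSubalgebra k D,
      (e (Ideal.Quotient.mk _ (X 0)) : P2 k) = X 0 ^ 4 - X 1 ^ 2 ∧
      (e (Ideal.Quotient.mk _ (X 1)) : P2 k) = X 0 ^ 3 ∧
      (e (Ideal.Quotient.mk _ (X 2)) : P2 k) = X 1 ^ 3 := by
  have hrange := range_toP2 D hDu hDv
  have hmem (i : Fin 3) : ![X 0 ^ 4 - X 1 ^ 2, X 0 ^ 3, X 1 ^ 3] i ∈ kerSubalgebra k D := by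
    rw [← hrange, ← toP2_X]
    exact ⟨X i, rfl⟩
  refine ⟨fun D' hu hv ↦ ?_, fun g ↦ ?_, hmem 0, hmem 1, hmem 2, ?_⟩
  · ext1 g
    obtain ⟨c, rfl⟩ := ofDigits_surjective g
    rw [D.map_ofDigits hDu hDv, D'.map_ofDigits hu hv]
  · obtain ⟨c, rfl⟩ := ofDigits_surjective g
    simp only [D.map_ofDigits hDu hDv, derivDigits_iterate_three, ofDigits_zero]
  · refine ⟨((Ideal.quotientEquivAlgOfEq k ker_toP2.symm).trans
      (Ideal.quotientKerEquivRange toP2)).trans (Subalgebra.equivOfEq _ _ hrange), ?_, ?_, ?_⟩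
    · exact toP2_X 0
    · exact toP2_X 1
    · exact toP2_X 2
end
end
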